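/- Let A be an essential hyperplane arrangement in V = K^ℓ and H ∈ A. Assume that A is tame and that A is locally free along H. Then the Ziegler restriction (A^H, m^H) is tame, i.e., pd_{S̄} Ω^p(A^H, m^H) ≤ p for all 0 ≤ p ≤ ℓ−1, where S̄ = S/α_H S. -/

import Mathlib

noncomputable section
open Classical MvPolynomial

/-- `pdLE R n M` : the `R`-module `M` has projective dimension at most `n`. -/
def pdLE (R : Type) [CommRing R] : ℕ → (M : Type) → [AddCommGroup M] → [Module R M] → Prop
  | 0, M, _, _ => Module.Projective R M
  | n + 1, M, _, _ => ∃ (ι : Type) (f : (ι →₀ R) →ₗ[R] M),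
      Function.Surjective f ∧ pdLE R n (LinearMap.ker f)

/-- Projective dimension as an element of `ℕ∞`. -/
def pdim (R : Type) [CommRing R] (M : Type) [AddCommGroup M] [Module R M] : ℕ∞ :=
  sInf {n : ℕ∞ | ∃ k : ℕ, pdLE R k M ∧ n = (k : ℕ∞)}

/-- The coordinate ring `S = K[x_1, …, x_ℓ]`. -/
abbrev PS (K : Type) [Field K] (ℓ : ℕ) : Type := MvPolynomial (Fin ℓ) K

/-- The free `S`-module of polynomial differential forms of all degrees, realized as the
exterior algebra over `S` on the free module `S^ℓ` (with `dx_i` the standard basis). -/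
abbrev ExtF (K : Type) [Field K] (ℓ : ℕ) : Type :=
  ExteriorAlgebra (PS K ℓ) (Fin ℓ → PS K ℓ)

variable {K : Type} [Field K] {ℓ : ℕ}

/-- The module `Ω^p_V` of polynomial differential `p`-forms. -/
def formsP (K : Type) [Field K] (ℓ : ℕ) (p : ℕ) : Submodule (PS K ℓ) (ExtF K ℓ) :=
  (LinearMap.range (ExteriorAlgebra.ι (PS K ℓ) :
      (Fin ℓ → PS K ℓ) →ₗ[PS K ℓ] ExtF K ℓ)) ^ p

/-- The defining linear form `α = ∑ c_i x_i` of the hyperplane with coefficient vector `c`. -/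
def linP (c : Fin ℓ → K) : PS K ℓ := ∑ i, MvPolynomial.C (c i) * MvPolynomial.X i

/-- The constant one-form `dα = ∑ c_i dx_i`. -/
def dP (c : Fin ℓ → K) : ExtF K ℓ :=
  ExteriorAlgebra.ι (PS K ℓ) (fun i => MvPolynomial.C (c i))

/-- A central hyperplane arrangement in `K^ℓ`: a finite set of (pairwise non-proportional,
nonzero) coefficient vectors of defining linear forms, each representing the hyperplane
`{x : ∑ c_i x_i = 0}`. -/
structure Arrangement (K : Type) [Field K] (ℓ : ℕ) : Type where
  hyps : Finset (Fin ℓ → K)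
  ne_zero : ∀ c ∈ hyps, c ≠ 0
  nonprop : ∀ c ∈ hyps, ∀ c' ∈ hyps, c ≠ c' → ∀ t : K, c ≠ t • c'

/-- The polynomial model of the module `Ω^p(A,m)` of logarithmic `p`-forms of the
multiarrangement `(A,m)`; it is `Q(A,m)·Ω^p(A,m)`, i.e. the image of `Ω^p(A,m)` under the
degree-shifting isomorphism given by multiplication with `Q(A,m)`, so that
`η = Q(A,m)·ω` ranges over polynomial `p`-forms with `dα_H ∧ η ∈ α_H^{m(H)} Ω^{p+1}_V`
for all `H ∈ A`. -/
def Omega (A : Arrangement K ℓ) (m : (Fin ℓ → K) → ℕ) (p : ℕ) :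
    Submodule (PS K ℓ) (ExtF K ℓ) :=
  formsP K ℓ p ⊓ ⨅ c ∈ A.hyps,
    Submodule.comap (LinearMap.mulLeft (PS K ℓ) (dP c))
      (Submodule.map (LinearMap.lsmul (PS K ℓ) (ExtF K ℓ) (linP c ^ m c))
        (formsP K ℓ (p + 1)))

/-- Tameness of a multiarrangement: `pd_S Ω^p(A,m) ≤ p` for all `0 ≤ p ≤ ℓ`. -/
def TameM (A : Arrangement K ℓ) (m : (Fin ℓ → K) → ℕ) : Prop :=
  ∀ p : ℕ, p ≤ ℓ → pdLE (PS K ℓ) p (Omega A m p)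

/-- Tameness of a simple arrangement (constant multiplicity `1`). -/
def Tame (A : Arrangement K ℓ) : Prop := TameM A (fun _ => 1)

/-- Freeness of a multiarrangement: `Ω^1(A,m)` is a free `S`-module. -/
def FreeM (A : Arrangement K ℓ) (m : (Fin ℓ → K) → ℕ) : Prop :=
  Module.Free (PS K ℓ) (Omega A m 1)

/-- An arrangement is essential when the intersection of its hyperplanes is `{0}`,
equivalently the defining forms span the dual space. -/
def Essential (A : Arrangement K ℓ) : Prop :=
  Submodule.span K (A.hyps : Set (Fin ℓ → K)) = ⊤

/-- The localization `A_x = {H ∈ A : x ∈ H}` of an arrangement at a point `x`. -/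
def locArr (A : Arrangement K ℓ) (x : Fin ℓ → K) : Arrangement K ℓ where
  hyps := A.hyps.filter (fun c => ∑ i, c i * x i = 0)
  ne_zero := fun c hc => A.ne_zero c (Finset.mem_filter.mp hc).1
  nonprop := fun c hc c' hc' =>
    A.nonprop c (Finset.mem_filter.mp hc).1 c' (Finset.mem_filter.mp hc').1

/-- `(A,m)` is locally free along the hyperplane `{x : ∑ (c0)_i x_i = 0}` :
`(A_x, m_x)` is free for every nonzero point `x` of this hyperplane. -/
def LocallyFreeAlong (A : Arrangement K ℓ) (m : (Fin ℓ → K) → ℕ) (c0 : Fin ℓ → K) : Prop :=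
  ∀ x : Fin ℓ → K, x ≠ 0 → (∑ i, c0 i * x i = 0) → FreeM (locArr A x) m

/-- The deletion `A ∖ {H}`. -/
def delArr (A : Arrangement K ℓ) (c0 : Fin ℓ → K) : Arrangement K ℓ where
  hyps := A.hyps.erase c0
  ne_zero := fun c hc => A.ne_zero c (Finset.mem_of_mem_erase hc)
  nonprop := fun c hc c' hc' =>
    A.nonprop c (Finset.mem_of_mem_erase hc) c' (Finset.mem_of_mem_erase hc')

/-- The coefficient vector of the restriction of the linear form `c` to the hyperplane `H`
along the linear identification `e : K^{ℓ-1} ≃ H`. -/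
def restrictForm (e : (Fin (ℓ - 1) → K) →ₗ[K] (Fin ℓ → K)) (c : Fin ℓ → K) :
    Fin (ℓ - 1) → K := fun i => ∑ j, c j * e (Pi.single i 1) j

/-- The linear form on `K^ℓ` with coefficient vector `c`. -/
def dotLin (c : Fin ℓ → K) : (Fin ℓ → K) →ₗ[K] K := ∑ i, c i • LinearMap.proj i

/-- `e` identifies `K^{ℓ-1}` with the hyperplane `ker(α_{c0})`. -/
def IsHypEmbedding (c0 : Fin ℓ → K) (e : (Fin (ℓ - 1) → K) →ₗ[K] (Fin ℓ → K)) : Prop :=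
  Function.Injective e ∧ LinearMap.range e = LinearMap.ker (dotLin c0)

/-- `B` (an arrangement in `K^{ℓ-1}`) represents the restriction `A^H` of `A` to the
hyperplane `H` determined by `c0 ∈ A`, via the identification `e : K^{ℓ-1} ≃ H`:
its hyperplanes are exactly the restrictions to `H` of the hyperplanes of `A ∖ {H}`. -/
def IsRestrictionOf (B : Arrangement K (ℓ - 1)) (A : Arrangement K ℓ) (c0 : Fin ℓ → K)
    (e : (Fin (ℓ - 1) → K) →ₗ[K] (Fin ℓ → K)) : Prop :=
  (∀ c ∈ A.hyps, c ≠ c0 → ∃ c' ∈ B.hyps, ∃ t : K, t ≠ 0 ∧ restrictForm e c = t • c') ∧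
  (∀ c' ∈ B.hyps, ∃ c ∈ A.hyps, c ≠ c0 ∧ ∃ t : K, t ≠ 0 ∧ restrictForm e c = t • c')
/-- The Ziegler multiplicity `m^H` on the restriction: `m^H(X) = #{L ∈ A∖{H} : L ∩ H = X}`. -/
def zieglerMult (A : Arrangement K ℓ) (c0 : Fin ℓ → K)
    (e : (Fin (ℓ - 1) → K) →ₗ[K] (Fin ℓ → K)) (c' : Fin (ℓ - 1) → K) : ℕ :=
  (A.hyps.filter (fun c => c ≠ c0 ∧ ∃ t : K, t ≠ 0 ∧ restrictForm e c = t • c')).card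

/-- The wedge `dx_{i_1} ∧ ⋯ ∧ dx_{i_p}` for a list of indices. -/
def wedgeList (l : List (Fin ℓ)) : ExtF K ℓ :=
  (l.map (fun i => ExteriorAlgebra.ι (PS K ℓ) (Pi.single i (1 : PS K ℓ)))).prod

/-- A polynomial `p`-form is homogeneous of (coefficient) degree `d` if it is a sum of
terms `f · dx_{i_1} ∧ ⋯ ∧ dx_{i_p}` with `f` homogeneous of degree `d`. -/
def IsHomogForm (p d : ℕ) (η : ExtF K ℓ) : Prop :=
  η ∈ AddSubgroup.closure {ξ : ExtF K ℓ | ∃ (f : PS K ℓ) (l : List (Fin ℓ)),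
    f.IsHomogeneous d ∧ l.length = p ∧ ξ = f • wedgeList l}

/-- `|m| = ∑_{H ∈ A} m(H)`. -/
def msum (A : Arrangement K ℓ) (m : (Fin ℓ → K) → ℕ) : ℕ := ∑ c ∈ A.hyps, m c

/-- The multiarrangement `(A,m)` is free with exponents `(d_1, …, d_ℓ)`: the polynomial
model of `Ω^1(A,m)` has a homogeneous basis whose `i`-th member has coefficient degree
`|m| - d_i`. -/
def FreeWithExp (A : Arrangement K ℓ) (m : (Fin ℓ → K) → ℕ) (d : Fin ℓ → ℕ) : Prop :=
  ∃ b : Fin ℓ → ExtF K ℓ,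
    (∀ i, b i ∈ Omega A m 1) ∧
    (∀ i, IsHomogForm 1 (msum A m - d i) (b i)) ∧
    LinearIndependent (PS K ℓ) b ∧
    Omega A m 1 ≤ Submodule.span (PS K ℓ) (Set.range b)

/-- The exponent vector `(d_1, d_2, 0, …, 0)`. -/
def expVec (d1 d2 : ℕ) : Fin ℓ → ℕ := fun i =>
  if (i : ℕ) = 0 then d1 else if (i : ℕ) = 1 then d2 else 0

/-- The localization `A_X` of `A` at the lattice element `X = H ∩ L` corresponding,
via the identification `e` of `H` with `K^{ℓ-1}`, to the hyperplane of `H`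
with coefficient vector `c'`. -/
def locOnRestr (A : Arrangement K ℓ) (e : (Fin (ℓ - 1) → K) →ₗ[K] (Fin ℓ → K))
    (c' : Fin (ℓ - 1) → K) : Arrangement K ℓ where
  hyps := A.hyps.filter (fun c => ∃ t : K, restrictForm e c = t • c')
  ne_zero := fun c hc => A.ne_zero c (Finset.mem_filter.mp hc).1
  nonprop := fun c hc c'' hc'' =>
    A.nonprop c (Finset.mem_filter.mp hc).1 c'' (Finset.mem_filter.mp hc'').1

/-- The multiplicity `m - δ_H`. -/
def mdel (m : (Fin ℓ → K) → ℕ) (c0 : Fin ℓ → K) : (Fin ℓ → K) → ℕ :=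
  fun c => if c = c0 then m c - 1 else m c

/-- `ms` is the Euler multiplicity `m^*` on the restriction `B = A^H` (presented via the
identification `e`): for each `X ∈ A^H` the rank-two localization `(A_X, m_X)` is free
with exponents `(d_1^X, d_2^X, 0, …, 0)` ordered so that `(A_X, m_X - δ_H)` is free with
exponents `(d_1^X - 1, d_2^X, 0, …, 0)`, and `m^*(X) = d_2^X`. -/
def IsEulerMult (A : Arrangement K ℓ) (m : (Fin ℓ → K) → ℕ) (c0 : Fin ℓ → K)
    (e : (Fin (ℓ - 1) → K) →ₗ[K] (Fin ℓ → K)) (B : Arrangement K (ℓ - 1))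
    (ms : (Fin (ℓ - 1) → K) → ℕ) : Prop :=
  ∀ c' ∈ B.hyps, ∃ d1 d2 : ℕ,
    FreeWithExp (locOnRestr A e c') m (expVec d1 d2) ∧
    FreeWithExp (locOnRestr A e c') (mdel m c0) (expVec (d1 - 1) d2) ∧
    ms c' = d2

/-- An arrangement is generic if any `k ≤ ℓ-1` of its hyperplanes intersect in
codimension `k`, i.e. any `≤ ℓ-1` of its defining forms are linearly independent. -/
def GenericArr (A : Arrangement K ℓ) : Prop :=
  ∀ s : Finset (Fin ℓ → K), s ⊆ A.hyps → s.card ≤ ℓ - 1 →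
    LinearIndependent K (fun x : {c // c ∈ s} => (x : Fin ℓ → K))

/-- An arrangement is irreducible if it is not a product of two lower-dimensional
arrangements, i.e. its defining forms cannot be split into two complementary proper
subspaces of the dual space. -/
def IrreducibleArr (A : Arrangement K ℓ) : Prop :=
  ¬ ∃ U1 U2 : Submodule K (Fin ℓ → K), U1 ≠ ⊥ ∧ U2 ≠ ⊥ ∧ U1 ⊓ U2 = ⊥ ∧ U1 ⊔ U2 = ⊤ ∧
      ∀ c ∈ A.hyps, c ∈ U1 ∨ c ∈ U2

/-- The defining polynomial `Q(A,m) = ∏_{H ∈ A} α_H^{m(H)}`. -/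
def Qpoly (A : Arrangement K ℓ) (m : (Fin ℓ → K) → ℕ) : PS K ℓ :=
  ∏ c ∈ A.hyps, linP c ^ m c

section HomologicalAlgebra

open CategoryTheory Abelian RingTheory.Sequence

universe u

theorem pdLE_iff_hasProjectiveDimensionLE (R : Type) [CommRing R] (n : ℕ) (M : Type)
    [AddCommGroup M] [Module R M] :
    pdLE R n M ↔ HasProjectiveDimensionLE (ModuleCat.of R M) n := by
  induction n generalizing M with
  | zero =>
    rw [pdLE, ← projective_iff_hasProjectiveDimensionLE_zero, IsProjective.iff_projective]
  | succ n ih =>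
    rw [pdLE]
    constructor
    · rintro ⟨ι, f, hf, h⟩
      have hS := LinearMap.shortExact_shortComplexKer hf
      have : Projective f.shortComplexKer.X₂ :=
        (IsProjective.iff_projective (R := R) (ι →₀ R)).1 inferInstance
      exact (hS.hasProjectiveDimensionLT_X₃_iff n this).2 ((ih _).1 h)
    · intro h
      refine ⟨M, Finsupp.linearCombination R (id : M → M),
        fun m => ⟨Finsupp.single m 1, by simp⟩, ?_⟩
      have hS := LinearMap.shortExact_shortComplexKer
        (f := Finsupp.linearCombination R (id : M → M)) (fun m => ⟨Finsupp.single m 1, by simp⟩)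
      have : Projective (Finsupp.linearCombination R (id : M → M)).shortComplexKer.X₂ :=
        (IsProjective.iff_projective (R := R) (M →₀ R)).1 inferInstance
      exact (ih _).2 ((hS.hasProjectiveDimensionLT_X₃_iff n this).1 h)

theorem pdLE_mono {R : Type} [CommRing R] {m n : ℕ} (hmn : m ≤ n) {M : Type}
    [AddCommGroup M] [Module R M] (h : pdLE R m M) : pdLE R n M := by
  rw [pdLE_iff_hasProjectiveDimensionLE] at h ⊢
  exact hasProjectiveDimensionLT_of_ge _ (m + 1) (n + 1) (by omega)

theorem pdLE_of_linearEquiv {R : Type} [CommRing R] {n : ℕ} {M N : Type}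
    [AddCommGroup M] [Module R M] [AddCommGroup N] [Module R N] (e : M ≃ₗ[R] N)
    (h : pdLE R n M) : pdLE R n N := by
  rw [pdLE_iff_hasProjectiveDimensionLE] at h ⊢
  exact hasProjectiveDimensionLT_of_iso e.toModuleIso _

theorem pdLE_of_retract {R : Type} [CommRing R] {n : ℕ} {M N : Type}
    [AddCommGroup M] [Module R M] [AddCommGroup N] [Module R N]
    (i : N →ₗ[R] M) (r : M →ₗ[R] N) (hri : r ∘ₗ i = LinearMap.id)
    (h : pdLE R n M) : pdLE R n N := by
  rw [pdLE_iff_hasProjectiveDimensionLE] at h ⊢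
  have : Retract (ModuleCat.of R N) (ModuleCat.of R M) :=
    { i := ModuleCat.ofHom i
      r := ModuleCat.ofHom r
      retract := by rw [← ModuleCat.ofHom_comp, hri]; rfl }
  exact this.hasProjectiveDimensionLT _

/-- If every module has projective dimension at most `n`, then a second syzygy has projective
dimension at most `n - 2`. -/
theorem pdLE_ker_of_forall_pdLE {R : Type} [CommRing R] {n : ℕ}
    (hn : ∀ (M : Type) [AddCommGroup M] [Module R M], pdLE R n M)
    {F G : Type} [AddCommGroup F] [Module R F] [AddCommGroup G] [Module R G]
    [Module.Projective R F] [Module.Projective R G] (f : F →ₗ[R] G) :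
    pdLE R (n - 2) (LinearMap.ker f) := by
  rw [pdLE_iff_hasProjectiveDimensionLE]
  have h1 := LinearMap.shortExact_shortComplexKer f.surjective_rangeRestrict
  have h2 := LinearMap.shortExact_shortComplexKer (LinearMap.range f).mkQ_surjective
  have p1 : Projective f.rangeRestrict.shortComplexKer.X₂ :=
    (IsProjective.iff_projective (R := R) F).1 inferInstance
  have p2 : Projective (LinearMap.range f).mkQ.shortComplexKer.X₂ :=
    (IsProjective.iff_projective (R := R) G).1 inferInstance
  have q : HasProjectiveDimensionLT (ModuleCat.of R (G ⧸ LinearMap.range f)) (n - 2 + 2 + 1) := by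
    have := (pdLE_iff_hasProjectiveDimensionLE R n (G ⧸ LinearMap.range f)).1 (hn _)
    exact hasProjectiveDimensionLT_of_ge _ (n + 1) _ (by omega)
  have q2 := (h2.hasProjectiveDimensionLT_X₃_iff _ p2).1 q
  have e : LinearMap.ker (LinearMap.range f).mkQ ≃ₗ[R] LinearMap.range f :=
    LinearEquiv.ofEq _ _ (Submodule.ker_mkQ _)
  have q3 : HasProjectiveDimensionLT (ModuleCat.of R (LinearMap.range f)) (n - 2 + 1 + 1) :=
    hasProjectiveDimensionLT_of_iso e.toModuleIso _
  have q4 := (h1.hasProjectiveDimensionLT_X₃_iff _ p1).1 q3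
  have e2 : LinearMap.ker f.rangeRestrict ≃ₗ[R] LinearMap.ker f :=
    LinearEquiv.ofEq _ _ (LinearMap.ker_rangeRestrict f)
  exact hasProjectiveDimensionLT_of_iso e2.toModuleIso _

/-- Reduction modulo a nonzerodivisor does not increase the projective dimension. -/
theorem pdLE_of_semilinear {R R' : Type} [CommRing R] [CommRing R'] [IsDomain R] (ρ : R →+* R')
    (hρ : Function.Surjective ρ) (a : R) (ha : a ≠ 0) (hker : ∀ r, ρ r = 0 → a ∣ r)
    (hρa : ρ a = 0) (n : ℕ) (L N : Type)
    [AddCommGroup L] [Module R L] [AddCommGroup N] [Module R' N] (f : L →ₛₗ[ρ] N)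
    (hf : Function.Surjective f) (hfk : ∀ x, f x = 0 → ∃ y, x = a • y)
    (hL : ∀ x : L, a • x = 0 → x = 0) (h : pdLE R n L) : pdLE R' n N := by
  have kerfin : ∀ (ι : Type) (v : ι →₀ R), v.mapRange ρ (map_zero ρ) = 0 → ∃ w, v = a • w := by
    intro ι v hv
    choose g hg using fun i => hker (v i) (by simpa using DFunLike.congr_fun hv i)
    refine ⟨Finsupp.onFinset v.support g ?_, ?_⟩
    · intro i hi
      rw [Finsupp.mem_support_iff, hg i]
      exact mul_ne_zero ha hi
    · ext i
      simp [← hg i]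
  have surfin : ∀ (ι : Type) (v : ι →₀ R'), ∃ w : ι →₀ R, w.mapRange ρ (map_zero ρ) = v := by
    intro ι v
    exact Finsupp.mapRange_surjective _ (map_zero ρ) hρ v
  induction n generalizing L N with
  | zero =>
    obtain ⟨s, hs⟩ := Module.projective_def'.1 (show Module.Projective R L from h)
    let F : (N →₀ R') →ₗ[R'] N := Finsupp.linearCombination R' id
    let c : (L →₀ R) →+ (N →₀ R') :=
      (Finsupp.mapDomain.addMonoidHom f).comp (Finsupp.mapRange.addMonoidHom ρ.toAddMonoidHom)
    have hcs : ∀ l x, c (Finsupp.single l x) = Finsupp.single (f l) (ρ x) := by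
      intro l x
      simp [c]
    have hc : ∀ (r : R) v, c (r • v) = ρ r • c v := by
      intro r v
      induction v using Finsupp.induction_linear with
      | zero => simp
      | add v w hv hw => rw [smul_add, map_add, hv, hw, map_add, smul_add]
      | single l x =>
        rw [Finsupp.smul_single, hcs, hcs, Finsupp.smul_single, smul_eq_mul, smul_eq_mul, map_mul]
    have hFc : ∀ v, F (c v) = f (Finsupp.linearCombination R id v) := by
      intro v
      induction v using Finsupp.induction_linear with
      | zero => simp
      | add v w hv hw => rw [map_add, map_add, hv, hw, map_add, map_add]
      | single l x => simp [c, F]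
    have key : ∀ x y : L, f x = f y → c (s x) = c (s y) := by
      intro x y hxy
      obtain ⟨z, hz⟩ := hfk (x - y) (by rw [map_sub, hxy, sub_self])
      have : x = y + a • z := by rw [← hz]; abel
      rw [this, map_add, map_add, map_smul, hc, hρa, zero_smul, add_zero]
    choose g hg using hf
    refine Module.projective_def'.2 ⟨
      { toFun := fun y => c (s (g y))
        map_add' := fun x y => by
          rw [← map_add, ← map_add]
          exact key _ _ (by simp [hg])
        map_smul' := fun r y => by
          obtain ⟨r, rfl⟩ := hρ r
          rw [RingHom.id_apply, ← hc, ← map_smul]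
          exact key _ _ (by simp [hg]) }, ?_⟩
    ext y
    change F (c (s (g y))) = y
    rw [hFc]
    have := LinearMap.congr_fun hs (g y)
    simp only [LinearMap.comp_apply, LinearMap.id_apply] at this
    rw [this, hg]
  | succ n ih =>
    obtain ⟨ι, F, hF, hn⟩ := h
    let b : (ι →₀ R') →ₗ[R'] N := Finsupp.linearCombination R' (fun i => f (F (Finsupp.single i 1)))
    let c : (ι →₀ R) →ₛₗ[ρ] (ι →₀ R') :=
      { toFun := fun v => v.mapRange ρ (map_zero ρ)
        map_add' := fun v w => by ext i; simp
        map_smul' := fun r v => by ext i; simp }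
    have hbc : ∀ v, b (c v) = f (F v) := by
      intro v
      induction v using Finsupp.induction_linear with
      | zero => simp
      | add v w hv hw => simp [hv, hw]
      | single l x =>
        have : Finsupp.single l x = x • Finsupp.single l (1 : R) := by simp
        simp only [c, b, LinearMap.coe_mk, AddHom.coe_mk, Finsupp.mapRange_single,
          Finsupp.linearCombination_single]
        rw [this, map_smul, map_smulₛₗ]
    refine ⟨ι, b, ?_, ?_⟩
    · intro y
      obtain ⟨x, rfl⟩ := hf y
      obtain ⟨v, rfl⟩ := hF x
      exact ⟨c v, hbc v⟩
    · let d : LinearMap.ker F →ₛₗ[ρ] LinearMap.ker b :=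
        LinearMap.codRestrict _ (c.comp (LinearMap.ker F).subtype) (fun v => by
          rw [LinearMap.mem_ker]
          change b (c v.1) = 0
          rw [hbc, LinearMap.mem_ker.1 v.2, map_zero])
      refine ih (LinearMap.ker F) (LinearMap.ker b) d ?_ ?_ ?_ hn
      · rintro ⟨y, hy⟩
        obtain ⟨w, rfl⟩ := surfin ι y
        rw [LinearMap.mem_ker] at hy
        have hy' : f (F w) = 0 := by rw [← hbc]; exact hy
        obtain ⟨z, hz⟩ := hfk _ hy'
        obtain ⟨z, rfl⟩ := hF z
        refine ⟨⟨w - a • z, by rw [LinearMap.mem_ker, map_sub, map_smul, hz, sub_self]⟩, ?_⟩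
        apply Subtype.ext
        change c (w - a • z) = _
        rw [map_sub, map_smulₛₗ, hρa, zero_smul, sub_zero]
        rfl
      · rintro ⟨x, hx⟩ h0
        obtain ⟨w, rfl⟩ := kerfin ι x (congrArg Subtype.val h0)
        refine ⟨⟨w, ?_⟩, rfl⟩
        rw [LinearMap.mem_ker] at hx ⊢
        exact hL _ (by rw [← map_smul, hx])
      · rintro ⟨x, hx⟩ h0
        have h0 := congrArg Subtype.val h0
        apply Subtype.ext
        change a • x = 0 at h0
        exact (smul_eq_zero.1 h0).resolve_left ha

end HomologicalAlgebra

section HomologicalAlgebra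

open CategoryTheory Abelian RingTheory.Sequence

theorem Ext_eq_zero_of_isWeaklyRegular {R : Type} [CommRing R] (T : ModuleCat.{0} R) (rs : List R)
    (hT : ∀ r ∈ rs, ∀ t : T, r • t = 0) (N : ModuleCat.{0} R) (hN : IsWeaklyRegular N rs)
    (i : ℕ) (hi : i < rs.length) (x : Ext T N i) : x = 0 := by
  induction rs generalizing N i with
  | nil => simp at hi
  | cons a rs ih =>
    rw [isWeaklyRegular_cons_iff] at hN
    have hS : (ShortComplex.mk (a • 𝟙 N) (N.smulShortComplex a).g
      (N.smulShortComplex a).zero).ShortExact := hN.1.smulShortComplex_shortExact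
    have ha : (a • 𝟙 T) = 0 := by
      ext t
      exact hT a List.mem_cons_self t
    have hx : x.comp (Ext.mk₀ (a • 𝟙 N)) (add_zero i) = 0 := by
      have h1 : x.comp (Ext.mk₀ (a • 𝟙 N)) (add_zero i) = a • x := by
        rw [Ext.mk₀_smul, Ext.comp_smul]
        exact congrArg _ (Ext.comp_mk₀_id x)
      have h2 : (Ext.mk₀ (a • 𝟙 T)).comp x (zero_add i) = a • x := by
        rw [Ext.mk₀_smul, Ext.smul_comp, Ext.mk₀_id_comp]
      rw [h1, ← h2, ha, Ext.mk₀_zero, Ext.zero_comp]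
    cases i with
    | zero =>
      obtain ⟨f, rfl⟩ := (Ext.mk₀_bijective T N).2 x
      rw [Ext.mk₀_comp_mk₀, ← Ext.mk₀_zero, (Ext.mk₀_bijective _ _).1.eq_iff] at hx
      have hmono : Mono (a • 𝟙 N) := hS.mono_f
      have hf : f = 0 := (cancel_mono (a • 𝟙 N)).1 (hx.trans Limits.zero_comp.symm)
      rw [hf, Ext.mk₀_zero]
    | succ i =>
      obtain ⟨y, hy⟩ := Ext.covariant_sequence_exact₁ T hS x hx rfl
      have hy0 : y = 0 := ih (fun r hr => hT r (List.mem_cons_of_mem _ hr)) _ hN.2 i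
        (by simpa using hi) y
      subst hy0
      exact hy.symm.trans (hS.extClass.zero_comp T i _ rfl)

theorem Ext_eq_zero_of_pdLE {R : Type} [CommRing R] (T : ModuleCat.{0} R) (rs : List R)
    (hT : ∀ r ∈ rs, ∀ t : T, r • t = 0) (hR : IsWeaklyRegular R rs) (d : ℕ) (N : Type)
    [AddCommGroup N] [Module R N] (hN : pdLE R d N) (i : ℕ) (hi : i + d < rs.length)
    (x : Ext T (ModuleCat.of R N) i) : x = 0 := by
  have flat : ∀ (P : Type) [AddCommGroup P] [Module R P] [Module.Flat R P],
      IsWeaklyRegular P rs := by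
    intro P _ _ _
    exact ((TensorProduct.rid R P).isWeaklyRegular_congr rs).1
      ((hR.isWeaklyRegular_lTensor (M₂ := P)))
  induction d generalizing N i with
  | zero =>
    have : Module.Projective R N := hN
    exact Ext_eq_zero_of_isWeaklyRegular T rs hT _ (flat N) i (by simpa using hi) x
  | succ d ih =>
    obtain ⟨ι, f, hf, hd⟩ := hN
    have hS := LinearMap.shortExact_shortComplexKer hf
    obtain ⟨y, hy⟩ := Ext.covariant_sequence_exact₃ T hS x rfl
      (ih _ hd (i + 1) (by omega) _)
    rw [← hy, Ext_eq_zero_of_isWeaklyRegular T rs hT _ (flat (ι →₀ R)) i (by omega) y,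
      Ext.zero_comp]

/-- A submodule of projective dimension `d` that contains the multiples of `u` by the members of
a weakly regular sequence of length at least `d + 2` contains `u`. -/
theorem mem_of_pdLE_of_isWeaklyRegular {R : Type} [CommRing R] {M : Type} [AddCommGroup M]
    [Module R M] (N : Submodule R M) (rs : List R) (hR : IsWeaklyRegular R rs) (d : ℕ)
    (hN : pdLE R d N) (hd : d + 2 ≤ rs.length)
    (hM : ∀ x : M, (∀ r ∈ rs, r • x = 0) → x = 0) (u : M) (hu : ∀ r ∈ rs, r • u ∈ N) : u ∈ N := by
  let I : Ideal R := Ideal.ofList rs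
  have hI : ∀ r ∈ I, r • u ∈ N := by
    intro r hr
    have : I ≤ Submodule.comap (LinearMap.toSpanSingleton R M u) N := by
      refine Ideal.span_le.2 fun r hr => ?_
      simpa using hu r hr
    simpa using this hr
  let T := ModuleCat.of R (R ⧸ I)
  have hT : ∀ r ∈ rs, ∀ t : T, r • t = 0 := by
    intro r hr t
    obtain ⟨t, rfl⟩ := Ideal.Quotient.mk_surjective (I := I) t
    change r • (Ideal.Quotient.mk I t) = 0
    rw [← Ideal.Quotient.mk_eq_mk, ← Submodule.Quotient.mk_smul, Submodule.Quotient.mk_eq_zero]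
    exact I.mul_mem_right _ (Ideal.subset_span hr)
  let φ : (R ⧸ I) →ₗ[R] (M ⧸ N) := Submodule.liftQ I
    (N.mkQ ∘ₗ LinearMap.toSpanSingleton R M u) (fun r hr => by
      simpa [← Submodule.Quotient.mk_smul, Submodule.Quotient.mk_eq_zero] using hI r hr)
  let S : ShortComplex (ModuleCat.{0} R) :=
    { X₁ := ModuleCat.of R N
      X₂ := ModuleCat.of R M
      X₃ := ModuleCat.of R (M ⧸ N)
      f := ModuleCat.ofHom N.subtype
      g := ModuleCat.ofHom N.mkQ
      zero := by ext x; simp }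
  have hS : S.ShortExact :=
    { exact := (ShortComplex.ShortExact.moduleCat_exact_iff_function_exact _).mpr
        (LinearMap.exact_subtype_mkQ N)
      mono_f := (ModuleCat.mono_iff_injective _).mpr N.injective_subtype
      epi_g := (ModuleCat.epi_iff_surjective _).mpr N.mkQ_surjective }
  obtain ⟨y, hy⟩ := Ext.covariant_sequence_exact₃ T hS (Ext.mk₀ (ModuleCat.ofHom φ)) rfl
    (Ext_eq_zero_of_pdLE T rs hT hR d N hN 1 (by omega) _)
  obtain ⟨ψ, rfl⟩ := (Ext.mk₀_bijective _ _).2 y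
  rw [Ext.mk₀_comp_mk₀, (Ext.mk₀_bijective _ _).1.eq_iff] at hy
  have hψ : ψ.hom (Submodule.Quotient.mk 1 : R ⧸ I) = 0 := by
    refine hM _ fun r hr => ?_
    rw [← map_smul, hT r hr, map_zero]
  have h1 := congrArg (fun g : T ⟶ S.X₃ => g.hom (Submodule.Quotient.mk 1 : R ⧸ I)) hy
  have h2 : S.g.hom (ψ.hom (Submodule.Quotient.mk 1 : R ⧸ I)) = N.mkQ u := by
    refine h1.trans ?_
    change φ (Submodule.Quotient.mk 1) = _
    simp only [φ]
    rw [Submodule.liftQ_apply]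
    simp
  rw [hψ, map_zero] at h2
  exact (Submodule.Quotient.mk_eq_zero N).1 h2.symm

/-- Powers of the variables form a weakly regular sequence. -/
theorem isWeaklyRegular_X_pow (K : Type) [Field K] (n k : ℕ) :
    IsWeaklyRegular (MvPolynomial (Fin n) K)
      ((List.finRange n).map fun i => (X i : MvPolynomial (Fin n) K) ^ k) := by
  set rs := (List.finRange n).map fun i => (X i : MvPolynomial (Fin n) K) ^ k with hrs
  have hlen : rs.length = n := by simp [rs]
  refine ⟨fun i hi => ?_⟩
  have hI : (Ideal.ofList (rs.take i) • (⊤ : Submodule (MvPolynomial (Fin n) K)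
      (MvPolynomial (Fin n) K))) = Ideal.span ((fun s => monomial s (1 : K)) ''
        {s | ∃ j : Fin n, j.val < i ∧ s = Finsupp.single j k}) := by
    rw [smul_eq_mul, Ideal.mul_top, Ideal.ofList]
    congr 1
    ext x
    simp only [List.mem_take_iff_getElem, Set.mem_ofPred_eq, Set.mem_image]
    constructor
    · rintro ⟨j, hj, rfl⟩
      have hj' : j < i := by omega
      refine ⟨_, ⟨⟨j, by omega⟩, hj', rfl⟩, ?_⟩
      simp [rs, X_pow_eq_monomial]
    · rintro ⟨_, ⟨j, hj, rfl⟩, rfl⟩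
      refine ⟨j, by have := j.2; omega, ?_⟩
      simp [rs, X_pow_eq_monomial]
  rw [hI]
  have hi' : i < n := by omega
  have hx : rs[i] = monomial (Finsupp.single ⟨i, hi'⟩ k) (1 : K) := by
    simp [rs, X_pow_eq_monomial]
  rw [hx, isSMulRegular_iff_right_eq_zero_of_smul]
  intro y hy
  obtain ⟨f, rfl⟩ := Submodule.Quotient.mk_surjective _ y
  rw [← Submodule.Quotient.mk_smul, Submodule.Quotient.mk_eq_zero, smul_eq_mul,
    mem_ideal_span_monomial_image] at hy
  rw [Submodule.Quotient.mk_eq_zero, mem_ideal_span_monomial_image]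
  intro m hm
  obtain ⟨_, ⟨j, hj, rfl⟩, hle⟩ := hy (Finsupp.single ⟨i, hi'⟩ k + m) (by
    rw [mem_support_iff, coeff_monomial_mul, one_mul]
    exact mem_support_iff.1 hm)
  refine ⟨_, ⟨j, hj, rfl⟩, ?_⟩
  rw [Finsupp.single_le_iff] at hle ⊢
  have : (⟨i, hi'⟩ : Fin n) ≠ j := by
    rintro rfl
    simp at hj
  simpa [Finsupp.single_apply, this] using hle

end HomologicalAlgebra

section HilbertSyzygy

open Polynomial CategoryTheory

variable {R : Type} [CommRing R]

/-- The `R[X]`-linear map `M[X] → N` induced by an `R`-linear map `M → N`. -/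
def polynomialModuleLift {M N : Type} [AddCommGroup M] [Module R M] [AddCommGroup N] [Module R N]
    [Module R[X] N] [IsScalarTower R R[X] N] (h : M →ₗ[R] N) : PolynomialModule R M →ₗ[R[X]] N where
  toFun y := y.coeff.sum fun i m => (Polynomial.X ^ i : R[X]) • h m
  map_add' x y := by
    rw [PolynomialModule.coeff_add]
    exact Finsupp.sum_add_index' (by simp) (by simp)
  map_smul' f y := by
    have hs : ∀ i m, (PolynomialModule.single R i m).coeff.sum
        (fun i m => (Polynomial.X ^ i : R[X]) • h m) = (Polynomial.X ^ i : R[X]) • h m := by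
      intro i m
      rw [PolynomialModule.coeff_single]
      exact Finsupp.sum_single_index (by simp)
    have ha : ∀ x y : PolynomialModule R M, (x + y).coeff.sum
        (fun i m => (Polynomial.X ^ i : R[X]) • h m) = x.coeff.sum
        (fun i m => (Polynomial.X ^ i : R[X]) • h m) + y.coeff.sum
        (fun i m => (Polynomial.X ^ i : R[X]) • h m) := by
      intro x y
      rw [PolynomialModule.coeff_add]
      exact Finsupp.sum_add_index' (by simp) (by simp)
    rw [RingHom.id_apply]
    induction y using PolynomialModule.induction_linear with
    | zero => simp
    | add x y hx hy => rw [smul_add, ha, hx, hy, ha, smul_add]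
    | single i m =>
      induction f using Polynomial.induction_on' with
      | add f g hf hg => rw [add_smul, ha, hf, hg, add_smul]
      | monomial j r =>
        rw [PolynomialModule.monomial_smul_single, hs, hs, smul_smul, map_smul,
          ← Polynomial.C_mul_X_pow_eq_monomial, mul_assoc, ← pow_add, mul_smul,
          ← algebraMap_smul R[X] r (h m), smul_smul, mul_comm, mul_smul]
        rfl

theorem polynomialModuleLift_single {M N : Type} [AddCommGroup M] [Module R M] [AddCommGroup N]
    [Module R N] [Module R[X] N] [IsScalarTower R R[X] N] (h : M →ₗ[R] N) (i : ℕ) (m : M) :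
    polynomialModuleLift h (PolynomialModule.single R i m) = (Polynomial.X ^ i : R[X]) • h m := by
  change (PolynomialModule.single R i m).coeff.sum
    (fun i m => (Polynomial.X ^ i : R[X]) • h m) = _
  rw [PolynomialModule.coeff_single]
  exact Finsupp.sum_single_index (by simp)

theorem X_pow_smul_single {M : Type} [AddCommGroup M] [Module R M] (i j : ℕ) (m : M) :
    (Polynomial.X ^ i : R[X]) • PolynomialModule.single R j m =
      PolynomialModule.single R (i + j) m := by
  rw [← Polynomial.monomial_one_right_eq_X_pow, PolynomialModule.monomial_smul_single, one_smul]

theorem polynomialModule_projective {M : Type} [AddCommGroup M] [Module R M]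
    [Module.Projective R M] : Module.Projective R[X] (PolynomialModule R M) := by
  let F := PolynomialModule R M →₀ R[X]
  let f : F →ₗ[R[X]] PolynomialModule R M := Finsupp.linearCombination R[X] id
  have hf : Function.Surjective f := fun m => 
    ⟨Finsupp.single m 1, (Finsupp.linearCombination_single _ _ _).trans (one_smul _ _)⟩
  obtain ⟨h, hh⟩ := Module.projective_lifting_property (f.restrictScalars R)
    (PolynomialModule.lsingle R 0 : M →ₗ[R] _) hf
  refine Module.Projective.of_split (polynomialModuleLift h) f ?_
  ext y : 1
  induction y using PolynomialModule.induction_linear with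
  | zero => simp
  | add x y hx hy => rw [map_add, map_add, hx, hy]
  | single i m =>
    have := LinearMap.congr_fun hh m
    simp only [LinearMap.comp_apply, LinearMap.restrictScalars_apply] at this
    rw [LinearMap.comp_apply, polynomialModuleLift_single, map_smul, this]
    exact X_pow_smul_single i 0 m

theorem pdLE_polynomialModule {n : ℕ} {M : Type} [AddCommGroup M] [Module R M]
    (h : pdLE R n M) : pdLE R[X] n (PolynomialModule R M) := by
  induction n generalizing M with
  | zero =>
    have : Module.Projective R M := h
    exact polynomialModule_projective
  | succ n ih =>
    obtain ⟨ι, f, hf, h⟩ := h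
    let up {A B : Type} [AddCommGroup A] [Module R A] [AddCommGroup B] [Module R B]
      (g : A →ₗ[R] B) : PolynomialModule R A →ₗ[R[X]] PolynomialModule R B :=
      polynomialModuleLift (PolynomialModule.lsingle R 0 ∘ₗ g)
    have hup {A B : Type} [AddCommGroup A] [Module R A] [AddCommGroup B] [Module R B]
        (g : A →ₗ[R] B) (y : PolynomialModule R A) (i : ℕ) : (up g y).coeff i = g (y.coeff i) := by
      induction y using PolynomialModule.induction_linear with
      | zero => simp
      | add x y hx hy => simp [hx, hy]
      | single j m =>
        have : up g (PolynomialModule.single R j m) = PolynomialModule.single R j (g m) := by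
          simp only [up]
          rw [polynomialModuleLift_single]
          exact X_pow_smul_single j 0 (g m)
        rw [this]
        simp only [PolynomialModule.coeff_single, Finsupp.single_apply]
        split_ifs <;> simp
    have hs : Function.Surjective (up f) := by
      intro y
      induction y using PolynomialModule.induction_linear with
      | zero => exact ⟨0, map_zero _⟩
      | add x y hx hy =>
        obtain ⟨a, rfl⟩ := hx
        obtain ⟨b, rfl⟩ := hy
        exact ⟨a + b, map_add _ _ _⟩
      | single i m =>
        obtain ⟨a, rfl⟩ := hf m
        refine ⟨PolynomialModule.single R i a, ?_⟩
        apply PolynomialModule.coeff_injective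
        ext j
        rw [hup]
        simp only [PolynomialModule.coeff_single, Finsupp.single_apply]
        split_ifs <;> simp
    let S : ShortComplex (ModuleCat.{0} R[X]) :=
      { X₁ := ModuleCat.of R[X] (PolynomialModule R (LinearMap.ker f))
        X₂ := ModuleCat.of R[X] (PolynomialModule R (ι →₀ R))
        X₃ := ModuleCat.of R[X] (PolynomialModule R M)
        f := ModuleCat.ofHom (up (LinearMap.ker f).subtype)
        g := ModuleCat.ofHom (up f)
        zero := by
          ext x j
          change (up f (up (LinearMap.ker f).subtype x)).coeff j = 0
          rw [hup, hup]
          exact (x.coeff j).2 }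
    have hS : S.ShortExact :=
      { exact := by
          refine (ShortComplex.ShortExact.moduleCat_exact_iff_function_exact _).mpr fun y => ?_
          constructor
          · intro hy
            have hy' : ∀ j, f (y.coeff j) = 0 := fun j => by
              rw [← hup]
              exact congrArg (fun z => PolynomialModule.coeff z j) hy
            refine ⟨.ofCoeff R (Finsupp.onFinset y.coeff.support
              (fun j => ⟨y.coeff j, hy' j⟩) ?_), ?_⟩
            · intro j hj
              rw [Finsupp.mem_support_iff]
              intro h0
              exact hj (Subtype.ext h0)
            · apply PolynomialModule.coeff_injective
              ext1 j
              refine (hup _ _ j).trans ?_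
              simp
          · rintro ⟨x, rfl⟩
            exact congrArg (fun g => g.hom x) S.zero
        mono_f := by
          refine (ModuleCat.mono_iff_injective _).mpr fun x y hxy => ?_
          apply PolynomialModule.coeff_injective
          ext1 j
          apply Subtype.ext
          have := congrArg (fun z => PolynomialModule.coeff z j) hxy
          exact (hup _ _ j).symm.trans (this.trans (hup _ _ j))
        epi_g := (ModuleCat.epi_iff_surjective _).mpr hs }
    have : Projective S.X₂ := (IsProjective.iff_projective (R := R[X]) _).1
      polynomialModule_projective
    rw [pdLE_iff_hasProjectiveDimensionLE]
    exact (hS.hasProjectiveDimensionLT_X₃_iff n this).2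
      ((pdLE_iff_hasProjectiveDimensionLE _ _ _).1 (ih h))

theorem pdLE_polynomial_succ {n : ℕ}
    (hn : ∀ (M : Type) [AddCommGroup M] [Module R M], pdLE R n M)
    (M : Type) [AddCommGroup M] [Module R[X] M] : pdLE R[X] (n + 1) M := by
  let _ : Module R M := Module.compHom M (Polynomial.C : R →+* R[X])
  have _ : IsScalarTower R R[X] M := ⟨fun r f m => by
    rw [Polynomial.smul_eq_C_mul, mul_smul]; rfl⟩
  let XM : M →ₗ[R] M := LinearMap.restrictScalars R
    (LinearMap.lsmul R[X] M (Polynomial.X : R[X]))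
  let φ : PolynomialModule R M →ₗ[R[X]] PolynomialModule R M :=
    polynomialModuleLift (PolynomialModule.lsingle R 1 - PolynomialModule.lsingle R 0 ∘ₗ XM)
  let π : PolynomialModule R M →ₗ[R[X]] M := polynomialModuleLift LinearMap.id
  have hXM : ∀ m, XM m = (Polynomial.X : R[X]) • m := fun m => rfl
  have hπ : ∀ i m, π (PolynomialModule.single R i m) = (Polynomial.X ^ i : R[X]) • m :=
    fun i m => polynomialModuleLift_single _ i m
  have hφ : ∀ i m, φ (PolynomialModule.single R i m) =
      PolynomialModule.single R (i + 1) m - PolynomialModule.single R i (XM m) := by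
    intro i m
    simp only [φ]
    rw [polynomialModuleLift_single, LinearMap.sub_apply, smul_sub]
    exact congrArg₂ _ (X_pow_smul_single i 1 m) (X_pow_smul_single i 0 _)
  have hπφ : ∀ y, π (φ y) = 0 := by
    intro y
    induction y using PolynomialModule.induction_linear with
    | zero => simp
    | add x y hx hy => rw [map_add, map_add, hx, hy, add_zero]
    | single i m => rw [hφ, map_sub, hπ, hπ, hXM, smul_smul, pow_succ, sub_self]
  have hex : ∀ y, ∃ z, y = φ z + PolynomialModule.single R 0 (π y) := by
    intro y
    induction y using PolynomialModule.induction_linear with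
    | zero => exact ⟨0, by simp⟩
    | add x y hx hy =>
      obtain ⟨a, ha⟩ := hx
      obtain ⟨b, hb⟩ := hy
      refine ⟨a + b, ?_⟩
      nth_rw 1 [ha, hb]
      rw [map_add, map_add, PolynomialModule.single_add]
      abel
    | single i m =>
      induction i generalizing m with
      | zero => exact ⟨0, by rw [hπ]; simp⟩
      | succ i ih =>
        obtain ⟨z, hz⟩ := ih (XM m)
        refine ⟨PolynomialModule.single R i m + z, ?_⟩
        rw [map_add, hφ, hπ, pow_succ, mul_smul, ← hXM, ← hπ, add_assoc, ← hz]
        abel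
  have hcoeff : ∀ y i, (φ y).coeff (i + 1) = y.coeff i - XM (y.coeff (i + 1)) := by
    intro y i
    induction y using PolynomialModule.induction_linear with
    | zero => simp
    | add x y hx hy => simp [hx, hy]; abel
    | single j m =>
      rw [hφ]
      change Finsupp.single (j + 1) m (i + 1) - Finsupp.single j (XM m) (i + 1) = _
      simp only [PolynomialModule.coeff_single, Finsupp.single_apply]
      congr 1
      · simp
      · split_ifs <;> simp
  have hinj : Function.Injective φ := by
    rw [← LinearMap.ker_eq_bot, LinearMap.ker_eq_bot']
    intro y hy
    have h1 : ∀ i, y.coeff i = XM (y.coeff (i + 1)) := by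
      intro i
      have := hcoeff y i
      rw [hy] at this
      exact (sub_eq_zero.1 this.symm)
    have h2 : ∀ k i, y.coeff (i + k) = 0 → y.coeff i = 0 := by
      intro k
      induction k with
      | zero => exact fun i h => h
      | succ k ih =>
        intro i h
        rw [h1, ih (i + 1) (by rw [← h]; congr 1; omega), map_zero]
    apply PolynomialModule.coeff_injective
    ext i
    obtain ⟨N, hN⟩ := y.coeff.support.bddAbove
    refine h2 (N + 1) i ?_
    by_contra h
    have := hN (Finsupp.mem_support_iff.2 h)
    omega
  let S : ShortComplex (ModuleCat.{0} R[X]) :=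
    { X₁ := ModuleCat.of R[X] (PolynomialModule R M)
      X₂ := ModuleCat.of R[X] (PolynomialModule R M)
      X₃ := ModuleCat.of R[X] M
      f := ModuleCat.ofHom φ
      g := ModuleCat.ofHom π
      zero := by
        ext x
        exact hπφ x }
  have hS : S.ShortExact :=
    { exact := by
        refine (ShortComplex.ShortExact.moduleCat_exact_iff_function_exact _).mpr fun y => ?_
        constructor
        · intro hy
          obtain ⟨z, hz⟩ := hex y
          have hy' : π y = 0 := hy
          refine ⟨z, ?_⟩
          rw [hy', PolynomialModule.single_zero, add_zero] at hz
          exact hz.symm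
        · rintro ⟨x, rfl⟩
          exact hπφ x
      mono_f := (ModuleCat.mono_iff_injective _).mpr hinj
      epi_g := (ModuleCat.epi_iff_surjective _).mpr fun m =>
        ⟨PolynomialModule.single R 0 m, (hπ 0 m).trans (by simp)⟩ }
  have h1 := (pdLE_iff_hasProjectiveDimensionLE _ _ _).1 (pdLE_polynomialModule (hn M))
  rw [pdLE_iff_hasProjectiveDimensionLE]
  exact hS.hasProjectiveDimensionLT_X₃ (n + 1) h1
    (hasProjectiveDimensionLT_of_ge _ (n + 1) _ (by omega))

theorem forall_pdLE_of_ringEquiv {R R' : Type} [CommRing R] [CommRing R'] (e : R ≃+* R') {n : ℕ}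
    (hn : ∀ (M : Type) [AddCommGroup M] [Module R M], pdLE R n M)
    (M : Type) [AddCommGroup M] [Module R' M] : pdLE R' n M := by
  let _ : Module R M := Module.compHom M (e : R →+* R')
  let _ := RingHomInvPair.of_ringEquiv e
  let _ := RingHomInvPair.symm (e : R →+* R') (e.symm : R' →+* R)
  let eM : M ≃ₛₗ[RingHomClass.toRingHom e] M :=
    { AddEquiv.refl M with map_smul' := fun r m => rfl }
  have := (pdLE_iff_hasProjectiveDimensionLE _ _ _).1 (hn M)
  rw [pdLE_iff_hasProjectiveDimensionLE]
  exact ModuleCat.hasProjectiveDimensionLE_of_semiLinearEquiv e (M := ModuleCat.of R M)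
    (N := ModuleCat.of R' M) eM n

/-- Hilbert's syzygy theorem. -/
theorem pdLE_mvPolynomial (K : Type) [Field K] (n : ℕ) (M : Type) [AddCommGroup M]
    [Module (MvPolynomial (Fin n) K) M] : pdLE (MvPolynomial (Fin n) K) n M := by
  induction n generalizing M with
  | zero =>
    exact forall_pdLE_of_ringEquiv (n := 0) (MvPolynomial.isEmptyRingEquiv K (Fin 0)).symm
      (fun M _ _ => show Module.Projective K M from inferInstance) M
  | succ n ih =>
    exact forall_pdLE_of_ringEquiv (MvPolynomial.finSuccEquiv K n).symm.toRingEquiv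
      (fun M _ _ => pdLE_polynomial_succ (fun M _ _ => ih M) M) M

end HilbertSyzygy

section Divisibility

theorem smul_dvd_iff_repr {R M ι : Type} [CommRing R] [IsDomain R] [AddCommGroup M] [Module R M]
    (b : Module.Basis ι R M) (a : R) (y : M) : (∃ z, y = a • z) ↔ ∀ i, a ∣ b.repr y i := by
  constructor
  · rintro ⟨z, rfl⟩ i
    exact ⟨b.repr z i, by simp⟩
  · intro h
    choose g hg using h
    by_cases ha : a = 0
    · refine ⟨0, ?_⟩
      rw [smul_zero]
      apply b.repr.injective
      ext i
      simp [hg, ha]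
    · refine ⟨b.repr.symm (Finsupp.onFinset (b.repr y).support g ?_), ?_⟩
      · intro i hi
        rw [Finsupp.mem_support_iff, hg i]
        exact mul_ne_zero ha hi
      · apply b.repr.injective
        ext i
        simp [hg]

/-- The form `y` is divisible by the polynomial `a`. -/
def FormDvd (a : PS K ℓ) (y : ExtF K ℓ) : Prop := ∃ z, y = a • z

/-- The basis of the module of forms given by the wedge monomials. -/
def extBasis (K : Type) [Field K] (ℓ : ℕ) : Module.Basis (Finset (Fin ℓ)) (PS K ℓ) (ExtF K ℓ) :=
  (Pi.basisFun (PS K ℓ) (Fin ℓ)).ExteriorAlgebra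

instance : Module.Free (PS K ℓ) (ExtF K ℓ) := Module.Free.of_basis (extBasis K ℓ)

instance : Module.Finite (PS K ℓ) (ExtF K ℓ) := Module.Finite.of_basis (extBasis K ℓ)

theorem formDvd_iff (a : PS K ℓ) (y : ExtF K ℓ) :
    FormDvd a y ↔ ∀ i, a ∣ (extBasis K ℓ).repr y i :=
  smul_dvd_iff_repr (extBasis K ℓ) a y

theorem FormDvd.add {a : PS K ℓ} {x y : ExtF K ℓ} (hx : FormDvd a x) (hy : FormDvd a y) :
    FormDvd a (x + y) := by
  obtain ⟨x, rfl⟩ := hx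
  obtain ⟨y, rfl⟩ := hy
  exact ⟨x + y, (smul_add _ _ _).symm⟩

theorem FormDvd.zero (a : PS K ℓ) : FormDvd a 0 := ⟨0, (smul_zero a).symm⟩

theorem FormDvd.neg {a : PS K ℓ} {x : ExtF K ℓ} (hx : FormDvd a x) : FormDvd a (-x) := by
  obtain ⟨x, rfl⟩ := hx
  exact ⟨-x, (smul_neg _ _).symm⟩

theorem FormDvd.sub {a : PS K ℓ} {x y : ExtF K ℓ} (hx : FormDvd a x) (hy : FormDvd a y) :
    FormDvd a (x - y) := by
  rw [sub_eq_add_neg]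
  exact hx.add hy.neg

theorem FormDvd.map {a : PS K ℓ} {x : ExtF K ℓ} (f : ExtF K ℓ →ₗ[PS K ℓ] ExtF K ℓ)
    (hx : FormDvd a x) : FormDvd a (f x) := by
  obtain ⟨x, rfl⟩ := hx
  exact ⟨f x, map_smul _ _ _⟩

theorem FormDvd.smul {a : PS K ℓ} {x : ExtF K ℓ} (s : PS K ℓ) (hx : FormDvd a x) :
    FormDvd a (s • x) := hx.map (LinearMap.lsmul (PS K ℓ) (ExtF K ℓ) s)

theorem FormDvd.mul_left {a : PS K ℓ} {x : ExtF K ℓ} (y : ExtF K ℓ) (hx : FormDvd a x) :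
    FormDvd a (y * x) := hx.map (LinearMap.mulLeft (PS K ℓ) y)

theorem FormDvd.mul_right {a : PS K ℓ} {x : ExtF K ℓ} (y : ExtF K ℓ) (hx : FormDvd a x) :
    FormDvd a (x * y) := hx.map (LinearMap.mulRight (PS K ℓ) y)

theorem FormDvd.of_dvd {a b : PS K ℓ} {x : ExtF K ℓ} (hab : a ∣ b) (hx : FormDvd b x) :
    FormDvd a x := by
  obtain ⟨c, rfl⟩ := hab
  obtain ⟨x, rfl⟩ := hx
  exact ⟨c • x, mul_smul _ _ _⟩

theorem FormDvd.smul_of_dvd {a b : PS K ℓ} (hab : a ∣ b) (x : ExtF K ℓ) : FormDvd a (b • x) :=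
  FormDvd.of_dvd hab ⟨x, rfl⟩

theorem formDvd_prod {ι : Type} (s : Finset ι) (f : ι → PS K ℓ)
    (hf : (s : Set ι).Pairwise fun i j => IsRelPrime (f i) (f j)) {x : ExtF K ℓ}
    (hx : ∀ i ∈ s, FormDvd (f i) x) : FormDvd (∏ i ∈ s, f i) x := by
  rw [formDvd_iff]
  intro j
  exact Finset.prod_dvd_of_isRelPrime hf fun i hi => (formDvd_iff _ _).1 (hx i hi) j

theorem FormDvd.of_smul_isRelPrime {a b : PS K ℓ} (hab : IsRelPrime a b) {x : ExtF K ℓ}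
    (hx : FormDvd a (b • x)) : FormDvd a x := by
  rw [formDvd_iff] at hx ⊢
  intro i
  have := hx i
  rw [map_smul, Finsupp.smul_apply, smul_eq_mul] at this
  exact hab.dvd_of_dvd_mul_left this

end Divisibility

section LinearForms

theorem coeff_linP (c : Fin ℓ → K) (i : Fin ℓ) :
    (linP c).coeff (Finsupp.single i 1) = c i := by
  simp [linP, coeff_sum, coeff_C_mul, coeff_X, Finsupp.single_left_inj]

theorem linP_injective : Function.Injective (linP : (Fin ℓ → K) → PS K ℓ) := by
  intro c d h
  ext i
  rw [← coeff_linP c i, h, coeff_linP]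

theorem linP_add (c d : Fin ℓ → K) : linP (c + d) = linP c + linP d := by
  simp [linP, add_mul, Finset.sum_add_distrib]

theorem linP_smul (t : K) (c : Fin ℓ → K) : linP (t • c) = C t * linP c := by
  simp [linP, Finset.mul_sum, mul_assoc]

theorem linP_zero : linP (0 : Fin ℓ → K) = 0 := by simp [linP]

theorem linP_ne_zero {c : Fin ℓ → K} (hc : c ≠ 0) : linP c ≠ 0 := by
  rw [← linP_zero]
  exact fun h => hc (linP_injective h)

theorem linP_isHomogeneous (c : Fin ℓ → K) : (linP c).IsHomogeneous 1 := by
  refine IsHomogeneous.sum _ _ _ fun i _ => ?_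
  simpa using (isHomogeneous_C (Fin ℓ) (c i)).mul (isHomogeneous_X K i)

theorem linP_irreducible {c : Fin ℓ → K} (hc : c ≠ 0) : Irreducible (linP c) := by
  apply irreducible_of_totalDegree_eq_one
  · exact (linP_isHomogeneous c).totalDegree (linP_ne_zero hc)
  · intro x hx
    obtain ⟨i, hi⟩ := Function.ne_iff.1 hc
    have := hx (Finsupp.single i 1)
    rw [coeff_linP] at this
    exact isUnit_iff_ne_zero.2 fun h0 => hi (by simpa [h0] using this)

theorem linP_isRelPrime {c d : Fin ℓ → K} (hc : c ≠ 0) (hd : d ≠ 0)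
    (hcd : ∀ t : K, c ≠ t • d) : IsRelPrime (linP c) (linP d) := by
  rw [(linP_irreducible hc).isRelPrime_iff_not_dvd]
  intro h
  obtain ⟨u, hu⟩ := (linP_irreducible hc).associated_of_dvd (linP_irreducible hd) h
  obtain ⟨t, ht, htu⟩ := MvPolynomial.isUnit_iff_eq_C_of_isReduced.1 u.isUnit
  rw [htu, mul_comm, ← linP_smul] at hu
  have h1 := linP_injective hu
  have ht0 := ht.ne_zero
  exact hcd t⁻¹ (by rw [← h1, smul_smul, inv_mul_cancel₀ ht0, one_smul])

theorem dP_add (c d : Fin ℓ → K) : dP (c + d) = dP c + dP d := by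
  rw [dP, dP, dP, ← map_add]
  congr 1
  ext i : 1
  simp

theorem dP_smul (t : K) (c : Fin ℓ → K) : dP (t • c) = (C t : PS K ℓ) • dP c := by
  rw [dP, dP, ← map_smul]
  congr 1
  ext i : 1
  simp

theorem dP_mul_self (c : Fin ℓ → K) : dP c * dP c = 0 := ExteriorAlgebra.ι_sq_zero _

theorem dP_mul_comm (c d : Fin ℓ → K) : dP c * dP d = -(dP d * dP c) := by
  have := ExteriorAlgebra.ι_add_mul_swap (R := PS K ℓ) (fun i => C (c i)) (fun i => C (d i))
  exact eq_neg_of_add_eq_zero_left this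

theorem ι_eq_sum (a : Fin ℓ → PS K ℓ) :
    ExteriorAlgebra.ι (PS K ℓ) a = ∑ i, a i • dP (Pi.single i 1 : Fin ℓ → K) := by
  conv_lhs => rw [pi_eq_sum_univ' a, map_sum]
  refine Finset.sum_congr rfl fun i _ => ?_
  rw [map_smul, dP]
  congr 2
  ext j : 1
  by_cases h : i = j <;> simp [h, eq_comm]

/-- Forms are generated as an algebra by the polynomials and the constant one-forms. -/
theorem extF_induction {P : ExtF K ℓ → Prop} (hC : ∀ f : PS K ℓ, P (algebraMap _ _ f))
    (hd : ∀ c : Fin ℓ → K, P (dP c)) (hmul : ∀ x y, P x → P y → P (x * y))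
    (hadd : ∀ x y, P x → P y → P (x + y)) (x : ExtF K ℓ) : P x := by
  induction x using ExteriorAlgebra.induction with
  | algebraMap f => exact hC f
  | ι a =>
    rw [ι_eq_sum]
    refine Finset.sum_induction _ P hadd (by simpa using hC 0) fun i _ => ?_
    rw [Algebra.smul_def]
    exact hmul _ _ (hC _) (hd _)
  | mul x y hx hy => exact hmul x y hx hy
  | add x y hx hy => exact hadd x y hx hy

/-- Forms are generated as a left module over the constant one-forms by the polynomials. -/
theorem extF_left_induction {P : ExtF K ℓ → Prop} (hC : ∀ f : PS K ℓ, P (algebraMap _ _ f))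
    (hd : ∀ (f : PS K ℓ) (c : Fin ℓ → K) x, P x → P (f • (dP c * x)))
    (hadd : ∀ x y, P x → P y → P (x + y)) (x : ExtF K ℓ) : P x := by
  induction x using CliffordAlgebra.left_induction with
  | algebraMap f => exact hC f
  | ι_mul x a hx =>
    change P (ExteriorAlgebra.ι (PS K ℓ) a * x)
    rw [ι_eq_sum, Finset.sum_mul]
    refine Finset.sum_induction _ P hadd (by simpa using hC 0) fun i _ => ?_
    rw [smul_mul_assoc]
    exact hd _ _ _ hx
  | add x y hx hy => exact hadd x y hx hy

theorem ι_mul_involute (a : Fin ℓ → PS K ℓ) (x : ExtF K ℓ) :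
    ExteriorAlgebra.ι (PS K ℓ) a * x =
      CliffordAlgebra.involute x * ExteriorAlgebra.ι (PS K ℓ) a := by
  induction x using ExteriorAlgebra.induction with
  | algebraMap f => rw [AlgHom.commutes, Algebra.commutes]
  | ι b =>
    have := ExteriorAlgebra.ι_add_mul_swap (R := PS K ℓ) a b
    rw [eq_neg_of_add_eq_zero_left this, ← neg_mul]
    congr 1
    exact (CliffordAlgebra.involute_ι b).symm
  | mul x y hx hy => rw [← mul_assoc, hx, mul_assoc, hy, map_mul, mul_assoc]
  | add x y hx hy => rw [mul_add, map_add, add_mul, hx, hy]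

end LinearForms

section Degree

theorem mem_formsP_of_smul_mem {p : ℕ} {a : PS K ℓ} (ha : a ≠ 0) {x : ExtF K ℓ}
    (h : a • x ∈ formsP K ℓ p) : x ∈ formsP K ℓ p := by
  let 𝒜 := fun i : ℕ => formsP K ℓ i
  have _ : GradedAlgebra 𝒜 := ExteriorAlgebra.gradedAlgebra (PS K ℓ) (Fin ℓ → PS K ℓ)
  have h1 : ∀ j, j ≠ p → (DirectSum.decompose 𝒜 x j : ExtF K ℓ) = 0 := by
    intro j hj
    have h2 : (DirectSum.decompose 𝒜 (a • x) j : ExtF K ℓ) = 0 :=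
      DirectSum.decompose_of_mem_ne 𝒜 h hj.symm
    rw [DirectSum.decompose_smul, DirectSum.smul_apply, Submodule.coe_smul] at h2
    exact (smul_eq_zero.1 h2).resolve_left ha
  rw [← DirectSum.sum_support_decompose 𝒜 x]
  refine Submodule.sum_mem _ fun j _ => ?_
  by_cases hj : j = p
  · subst hj
    exact (DirectSum.decompose 𝒜 x j).2
  · rw [h1 j hj]
    exact zero_mem _

theorem mul_mem_formsP {p q : ℕ} {x y : ExtF K ℓ} (hx : x ∈ formsP K ℓ p)
    (hy : y ∈ formsP K ℓ q) : x * y ∈ formsP K ℓ (p + q) := by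
  rw [formsP, pow_add]
  exact Submodule.mul_mem_mul hx hy

theorem ι_mem_formsP (a : Fin ℓ → PS K ℓ) : ExteriorAlgebra.ι (PS K ℓ) a ∈ formsP K ℓ 1 := by
  rw [formsP, pow_one]
  exact ⟨a, rfl⟩

theorem dP_mem_formsP (c : Fin ℓ → K) : dP c ∈ formsP K ℓ 1 := ι_mem_formsP _

theorem mem_formsP_one {x : ExtF K ℓ} (hx : x ∈ formsP K ℓ 1) :
    ∃ a, x = ExteriorAlgebra.ι (PS K ℓ) a := by
  rw [formsP, pow_one] at hx
  obtain ⟨a, rfl⟩ := hx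
  exact ⟨a, rfl⟩

theorem mem_formsP_zero {x : ExtF K ℓ} : x ∈ formsP K ℓ 0 ↔ ∃ f : PS K ℓ, x = algebraMap _ _ f := by
  rw [formsP, pow_zero, Submodule.mem_one]
  simp only [eq_comm]

theorem ι_mul_mem_formsP (a : Fin ℓ → PS K ℓ) {p : ℕ} {x : ExtF K ℓ} (hx : x ∈ formsP K ℓ p) :
    ExteriorAlgebra.ι (PS K ℓ) a * x ∈ formsP K ℓ (p + 1) := by
  rw [add_comm]
  exact mul_mem_formsP (ι_mem_formsP a) hx

theorem formsP_succ_induction {p : ℕ} {P : ExtF K ℓ → Prop}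
    (hι : ∀ (f : PS K ℓ) (c : Fin ℓ → K), ∀ x ∈ formsP K ℓ p, P (f • (dP c * x)))
    (hadd : ∀ x y, P x → P y → P (x + y))
    {x : ExtF K ℓ} (hx : x ∈ formsP K ℓ (p + 1)) : P x := by
  rw [formsP, pow_succ'] at hx
  refine Submodule.mul_induction_on hx ?_ fun x y => hadd x y
  rintro _ ⟨a, rfl⟩ x hx
  rw [ι_eq_sum, Finset.sum_mul]
  refine Finset.sum_induction _ P hadd ?_ fun i _ => ?_
  · simpa using hι 0 0 0 (zero_mem _)
  · rw [smul_mul_assoc]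
    exact hι _ _ _ hx

/-- Contraction of forms with a vector field, given as an element of the dual module. -/
def contr (d : Module.Dual (PS K ℓ) (Fin ℓ → PS K ℓ)) : ExtF K ℓ →ₗ[PS K ℓ] ExtF K ℓ :=
  CliffordAlgebra.contractLeft (Q := (0 : QuadraticForm (PS K ℓ) (Fin ℓ → PS K ℓ))) d

variable (d d' : Module.Dual (PS K ℓ) (Fin ℓ → PS K ℓ))

theorem contr_ι_mul (a : Fin ℓ → PS K ℓ) (x : ExtF K ℓ) :
    contr d (ExteriorAlgebra.ι (PS K ℓ) a * x) =
      d a • x - ExteriorAlgebra.ι (PS K ℓ) a * contr d x :=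
  CliffordAlgebra.contractLeft_ι_mul d a x

theorem contr_dP_mul (c : Fin ℓ → K) (x : ExtF K ℓ) :
    contr d (dP c * x) = d (fun i => C (c i)) • x - dP c * contr d x := contr_ι_mul d _ x

theorem contr_ι (a : Fin ℓ → PS K ℓ) :
    contr d (ExteriorAlgebra.ι (PS K ℓ) a) = algebraMap _ _ (d a) :=
  CliffordAlgebra.contractLeft_ι _ d a

theorem contr_algebraMap (f : PS K ℓ) : contr d (algebraMap _ _ f) = 0 :=
  CliffordAlgebra.contractLeft_algebraMap _ d f

theorem contr_contr (x : ExtF K ℓ) : contr d (contr d x) = 0 :=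
  CliffordAlgebra.contractLeft_contractLeft d x

theorem contr_comm (x : ExtF K ℓ) : contr d (contr d' x) = -contr d' (contr d x) :=
  CliffordAlgebra.contractLeft_comm d d' x

theorem contr_mem_formsP {p : ℕ} {x : ExtF K ℓ} (hx : x ∈ formsP K ℓ (p + 1)) :
    contr d x ∈ formsP K ℓ p := by
  induction p generalizing x with
  | zero =>
    refine formsP_succ_induction (P := fun x => contr d x ∈ formsP K ℓ 0) ?_ ?_ hx
    · intro f c x hx
      obtain ⟨g, rfl⟩ := mem_formsP_zero.1 hx
      rw [map_smul, contr_dP_mul, contr_algebraMap, mul_zero, sub_zero]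
      exact Submodule.smul_mem _ _ (Submodule.smul_mem _ _ hx)
    · intro x y hx hy
      rw [map_add]
      exact add_mem hx hy
  | succ p ih =>
    refine formsP_succ_induction (P := fun x => contr d x ∈ formsP K ℓ (p + 1)) ?_ ?_ hx
    · intro f c x hx
      rw [map_smul, contr_dP_mul]
      exact Submodule.smul_mem _ _ (sub_mem (Submodule.smul_mem _ _ hx)
        (ι_mul_mem_formsP _ (ih hx)))
    · intro x y hx hy
      rw [map_add]
      exact add_mem hx hy

/-- A form of positive degree that is annihilated by all constant contractions vanishes. -/
theorem eq_zero_of_contr_proj_eq_zero {p : ℕ} {u : ExtF K ℓ} (hu : u ∈ formsP K ℓ (p + 1))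
    (h : ∀ k : Fin ℓ, contr (LinearMap.proj k) u = 0) : u = 0 := by
  let e : Fin ℓ → ExtF K ℓ := fun k => dP (Pi.single k 1 : Fin ℓ → K)
  let T : Fin ℓ → ExtF K ℓ → ExtF K ℓ := fun k y => contr (LinearMap.proj k) (e k * y)
  have hT : ∀ k y, T k y = y - e k * contr (LinearMap.proj k) y := by
    intro k y
    simp only [T, e]
    rw [contr_dP_mul]
    simp
  have hTe : ∀ k j y, k ≠ j → T k (e j * y) = e j * T k y := by
    intro k j y hkj
    rw [hT, hT]
    simp only [e]
    rw [contr_dP_mul]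
    simp only [LinearMap.proj_apply, Pi.single_eq_of_ne hkj, map_zero, zero_smul, zero_sub, mul_neg,
      sub_neg_eq_add, mul_sub]
    rw [← mul_assoc, ← mul_assoc, dP_mul_comm, neg_mul, sub_eq_add_neg]
  have hTe0 : ∀ k y, T k (e k * y) = 0 := by
    intro k y
    rw [show T k (e k * y) = contr (LinearMap.proj k) (e k * (e k * y)) from rfl,
      ← mul_assoc, dP_mul_self, zero_mul, map_zero]
  have hTu : ∀ k, T k u = u := by
    intro k
    rw [hT, h, mul_zero, sub_zero]
  have hT0 : ∀ k, T k 0 = 0 := by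
    intro k
    simp [T]
  have hTadd : ∀ k x y, T k (x + y) = T k x + T k y := by
    intro k x y
    simp only [T]
    rw [mul_add, map_add]
  have hTs : ∀ k (f : PS K ℓ) y, T k (f • y) = f • T k y := by
    intro k f y
    simp only [T]
    rw [mul_smul_comm, map_smul]
  let F : List (Fin ℓ) → ExtF K ℓ → ExtF K ℓ := fun l y => l.foldr T y
  have hFu : ∀ l, F l u = u := by
    intro l
    induction l with
    | nil => rfl
    | cons k l ih => rw [show F (k :: l) u = T k (F l u) from rfl, ih, hTu]
  have hFadd : ∀ l x y, F l (x + y) = F l x + F l y := by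
    intro l x y
    induction l with
    | nil => rfl
    | cons k l ih =>
      rw [show F (k :: l) (x + y) = T k (F l (x + y)) from rfl, ih, hTadd]
      rfl
  have hFs : ∀ l (f : PS K ℓ) y, F l (f • y) = f • F l y := by
    intro l f y
    induction l with
    | nil => rfl
    | cons k l ih =>
      rw [show F (k :: l) (f • y) = T k (F l (f • y)) from rfl, ih, hTs]
      rfl
  have hFe : ∀ l j y, (j ∈ l → F l (e j * y) = 0) ∧ (j ∉ l → F l (e j * y) = e j * F l y) := by
    intro l j y
    induction l with
    | nil => exact ⟨fun h => absurd h List.not_mem_nil, fun _ => rfl⟩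
    | cons k l ih =>
      rw [show F (k :: l) (e j * y) = T k (F l (e j * y)) from rfl]
      by_cases hj : j ∈ l
      · rw [ih.1 hj, hT0]
        exact ⟨fun _ => rfl, fun h => absurd (List.mem_cons_of_mem _ hj) h⟩
      · rw [ih.2 hj]
        by_cases hk : k = j
        · subst hk
          exact ⟨fun _ => hTe0 _ _, fun h => absurd List.mem_cons_self h⟩
        · rw [hTe k j _ hk]
          exact ⟨fun h => ((List.mem_cons.1 h).elim (fun h => absurd h.symm hk)
            (fun h => absurd h hj)), fun _ => rfl⟩
  have hF0 : F (List.finRange ℓ) u = 0 := by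
    rw [formsP, pow_succ'] at hu
    refine Submodule.mul_induction_on (C := fun x => F (List.finRange ℓ) x = 0) hu ?_ ?_
    · rintro _ ⟨a, rfl⟩ x hx
      rw [ι_eq_sum, Finset.sum_mul]
      refine Finset.sum_induction _ (fun x => F (List.finRange ℓ) x = 0) ?_ ?_ fun i _ => ?_
      · intro x y hx hy
        rw [hFadd, hx, hy, add_zero]
      · simpa using hFs (List.finRange ℓ) 0 0
      · rw [smul_mul_assoc, hFs, (hFe _ i x).1 (List.mem_finRange i), smul_zero]
    · intro x y hx hy
      rw [hFadd, hx, hy, add_zero]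
  rw [← hFu (List.finRange ℓ), hF0]

end Degree

section Pullback

variable {n : ℕ}

/-- The pullback of a linear form along a linear map. -/
def pullForm (e : (Fin n → K) →ₗ[K] (Fin ℓ → K)) (c : Fin ℓ → K) : Fin n → K :=
  fun i => ∑ j, c j * e (Pi.single i 1) j

theorem pullForm_apply_sum (e : (Fin n → K) →ₗ[K] (Fin ℓ → K)) (c : Fin ℓ → K) (x : Fin n → K) :
    ∑ i, pullForm e c i * x i = ∑ j, c j * e x j := by
  have hx : e x = ∑ i, x i • e (Pi.single i 1) := by
    conv_lhs => rw [pi_eq_sum_univ' x, map_sum]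
    simp only [map_smul]
  simp only [pullForm, Finset.sum_mul]
  rw [Finset.sum_comm]
  refine Finset.sum_congr rfl fun j _ => ?_
  rw [hx, Finset.sum_apply, Finset.mul_sum]
  refine Finset.sum_congr rfl fun i _ => ?_
  simp only [Pi.smul_apply, smul_eq_mul]
  ring

/-- The pullback of polynomials along a linear map. -/
def pullPoly (e : (Fin n → K) →ₗ[K] (Fin ℓ → K)) : PS K ℓ →ₐ[K] PS K n :=
  aeval fun j => linP (pullForm e (Pi.single j 1))

theorem pullForm_add (e : (Fin n → K) →ₗ[K] (Fin ℓ → K)) (c d : Fin ℓ → K) :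
    pullForm e (c + d) = pullForm e c + pullForm e d := by
  ext i
  simp [pullForm, add_mul, Finset.sum_add_distrib]

theorem pullForm_smul (e : (Fin n → K) →ₗ[K] (Fin ℓ → K)) (t : K) (c : Fin ℓ → K) :
    pullForm e (t • c) = t • pullForm e c := by
  ext i
  simp [pullForm, Finset.mul_sum, mul_assoc]

theorem pullForm_eq_sum (e : (Fin n → K) →ₗ[K] (Fin ℓ → K)) (c : Fin ℓ → K) (i : Fin n) :
    pullForm e c i = ∑ j, c j * pullForm e (Pi.single j 1) i := by
  simp [pullForm, Pi.single_apply]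

theorem pullPoly_linP (e : (Fin n → K) →ₗ[K] (Fin ℓ → K)) (c : Fin ℓ → K) :
    pullPoly e (linP c) = linP (pullForm e c) := by
  have h : linP (pullForm e c) = ∑ j, C (c j) * linP (pullForm e (Pi.single j 1)) := by
    simp only [linP, Finset.mul_sum]
    rw [Finset.sum_comm]
    refine Finset.sum_congr rfl fun i _ => ?_
    rw [pullForm_eq_sum, map_sum, Finset.sum_mul]
    refine Finset.sum_congr rfl fun j _ => ?_
    rw [map_mul, mul_assoc]
  rw [h, linP, map_sum]
  refine Finset.sum_congr rfl fun j _ => ?_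
  rw [map_mul, pullPoly, aeval_X, aeval_C]
  rfl

theorem pullPoly_C (e : (Fin n → K) →ₗ[K] (Fin ℓ → K)) (t : K) :
    pullPoly e (C t) = C t := by
  rw [pullPoly, aeval_C]
  rfl

/-- The pullback of the coefficient vector of a polynomial one-form. -/
def pullVec (e : (Fin n → K) →ₗ[K] (Fin ℓ → K)) :
    (Fin ℓ → PS K ℓ) →ₛₗ[(pullPoly e : PS K ℓ →+* PS K n)] (Fin n → PS K n) where
  toFun a i := ∑ j, pullPoly e (a j) * C (e (Pi.single i 1) j)
  map_add' a b := by
    ext1 i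
    simp [add_mul, Finset.sum_add_distrib]
  map_smul' f a := by
    ext1 i
    simp [Finset.mul_sum, mul_assoc]

/-- The pullback of differential forms along a linear map. -/
def pullExt (e : (Fin n → K) →ₗ[K] (Fin ℓ → K)) : ExtF K ℓ →+* ExtF K n :=
  let _ : Algebra (PS K ℓ) (ExtF K n) :=
    ((algebraMap (PS K n) (ExtF K n)).comp (pullPoly e : PS K ℓ →+* PS K n)).toAlgebra'
      fun f x => Algebra.commutes (pullPoly e f) x
  (ExteriorAlgebra.lift (PS K ℓ)
    ⟨{ toFun := fun a => ExteriorAlgebra.ι (PS K n) (pullVec e a)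
       map_add' := fun a b => by rw [map_add, map_add]
       map_smul' := fun f a => by
        rw [LinearMap.map_smulₛₗ, map_smul, RingHom.id_apply, Algebra.smul_def, Algebra.smul_def]
        rfl },
      fun a => ExteriorAlgebra.ι_sq_zero _⟩ : ExtF K ℓ →ₐ[PS K ℓ] ExtF K n).toRingHom

variable (e : (Fin n → K) →ₗ[K] (Fin ℓ → K))

theorem pullExt_algebraMap (f : PS K ℓ) :
    pullExt e (algebraMap _ _ f) = algebraMap _ _ (pullPoly e f) := by
  let _ : Algebra (PS K ℓ) (ExtF K n) :=
    ((algebraMap (PS K n) (ExtF K n)).comp (pullPoly e : PS K ℓ →+* PS K n)).toAlgebra'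
      fun f x => Algebra.commutes (pullPoly e f) x
  exact AlgHom.commutes (ExteriorAlgebra.lift (PS K ℓ) _) f

theorem pullExt_ι (a : Fin ℓ → PS K ℓ) :
    pullExt e (ExteriorAlgebra.ι (PS K ℓ) a) = ExteriorAlgebra.ι (PS K n) (pullVec e a) := by
  let _ : Algebra (PS K ℓ) (ExtF K n) :=
    ((algebraMap (PS K n) (ExtF K n)).comp (pullPoly e : PS K ℓ →+* PS K n)).toAlgebra'
      fun f x => Algebra.commutes (pullPoly e f) x
  exact ExteriorAlgebra.lift_ι_apply (PS K ℓ) _ _ a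

theorem pullExt_dP (c : Fin ℓ → K) : pullExt e (dP c) = dP (pullForm e c) := by
  rw [dP, pullExt_ι, dP]
  congr 1
  ext1 i
  change ∑ j, pullPoly e (C (c j)) * C (e (Pi.single i 1) j) = _
  simp only [pullPoly_C, pullForm, map_sum, map_mul]

theorem pullExt_smul (f : PS K ℓ) (x : ExtF K ℓ) :
    pullExt e (f • x) = pullPoly e f • pullExt e x := by
  rw [Algebra.smul_def, map_mul, pullExt_algebraMap, ← Algebra.smul_def]

theorem pullExt_mem_formsP {p : ℕ} {x : ExtF K ℓ} (hx : x ∈ formsP K ℓ p) :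
    pullExt e x ∈ formsP K n p := by
  induction p generalizing x with
  | zero =>
    obtain ⟨f, rfl⟩ := mem_formsP_zero.1 hx
    rw [pullExt_algebraMap]
    exact mem_formsP_zero.2 ⟨_, rfl⟩
  | succ p ih =>
    refine formsP_succ_induction (P := fun x => pullExt e x ∈ formsP K n (p + 1)) ?_ ?_ hx
    · intro f c x hx
      rw [pullExt_smul, map_mul, pullExt_dP]
      exact Submodule.smul_mem _ _ (ι_mul_mem_formsP _ (ih hx))
    · intro x y hx hy
      rw [map_add]
      exact add_mem hx hy

theorem pullExt_contr (d : Module.Dual (PS K ℓ) (Fin ℓ → PS K ℓ))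
    (d' : Module.Dual (PS K n) (Fin n → PS K n))
    (h : ∀ c : Fin ℓ → K, pullPoly e (d fun i => C (c i)) = d' fun i => C (pullForm e c i))
    (x : ExtF K ℓ) : pullExt e (contr d x) = contr d' (pullExt e x) := by
  induction x using extF_left_induction with
  | hC f => rw [contr_algebraMap, pullExt_algebraMap, contr_algebraMap, map_zero]
  | hd f c x hx =>
    rw [map_smul, pullExt_smul, contr_dP_mul, map_sub, pullExt_smul, map_mul (pullExt e),
      pullExt_dP, pullExt_smul, map_mul (pullExt e), pullExt_dP, map_smul, contr_dP_mul, h, hx]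
  | hadd x y hx hy => rw [map_add, map_add, map_add, map_add, hx, hy]

end Pullback

section Hyperplane

variable {n : ℕ}

/-- A splitting `K^ℓ = im e ⊕ K v` along the hyperplane `{x : c₀ · x = 0} = im e`. -/
structure HypSplit (c0 : Fin ℓ → K) (e : (Fin n → K) →ₗ[K] (Fin ℓ → K)) where
  r : (Fin ℓ → K) →ₗ[K] (Fin n → K)
  v : Fin ℓ → K
  r_e : ∀ y, r (e y) = y
  c0_v : ∑ j, c0 j * v j = 1
  e_r : ∀ x, e (r x) + (∑ j, c0 j * x j) • v = x
  c0_e : ∀ y, ∑ j, c0 j * e y j = 0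

variable {c0 : Fin ℓ → K} {e : (Fin n → K) →ₗ[K] (Fin ℓ → K)}

theorem HypSplit.pullForm_c0 (s : HypSplit c0 e) : pullForm e c0 = 0 := by
  ext i
  exact s.c0_e _

theorem HypSplit.pullForm_pullForm_r (s : HypSplit c0 e) (c : Fin n → K) :
    pullForm e (pullForm s.r c) = c := by
  ext i
  have := pullForm_apply_sum s.r c (e (Pi.single i 1))
  rw [s.r_e] at this
  refine this.trans ?_
  simp [Pi.single_apply]

theorem HypSplit.pullForm_r_pullForm (s : HypSplit c0 e) (c : Fin ℓ → K) :
    c - pullForm s.r (pullForm e c) = (∑ j, c j * s.v j) • c0 := by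
  ext k
  have h1 := pullForm_apply_sum e c (s.r (Pi.single k 1))
  have h2 : ∑ j, c j * (e (s.r (Pi.single k 1)) + c0 k • s.v) j = c k := by
    have := s.e_r (Pi.single k 1)
    simp only [Pi.single_apply, mul_ite, mul_one, mul_zero, Finset.sum_ite_eq', Finset.mem_univ,
      if_true] at this
    rw [this]
    simp [Pi.single_apply]
  change c k - (∑ j, pullForm e c j * s.r (Pi.single k 1) j) = _
  rw [h1, ← h2]
  simp only [Pi.add_apply, Pi.smul_apply, smul_eq_mul, mul_add, Finset.sum_add_distrib]
  rw [add_sub_cancel_left, Finset.sum_mul]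
  exact Finset.sum_congr rfl fun j _ => by ring

theorem HypSplit.pullPoly_pullPoly_r (s : HypSplit c0 e) (f : PS K n) :
    pullPoly e (pullPoly s.r f) = f := by
  have : (pullPoly e).comp (pullPoly s.r) = AlgHom.id K (PS K n) := by
    apply MvPolynomial.algHom_ext
    intro i
    have hX : (X i : PS K n) = linP (Pi.single i 1) := by
      simp [linP, Pi.single_apply]
    rw [AlgHom.comp_apply, hX, pullPoly_linP, pullPoly_linP, s.pullForm_pullForm_r]
    rfl
  exact congrArg (fun g => g f) this

theorem HypSplit.linP_dvd_sub (s : HypSplit c0 e) (f : PS K ℓ) :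
    linP c0 ∣ f - pullPoly s.r (pullPoly e f) := by
  induction f using MvPolynomial.induction_on with
  | C t => rw [pullPoly_C, pullPoly_C, sub_self]; exact dvd_zero _
  | add f g hf hg =>
    rw [map_add, map_add, add_sub_add_comm]
    exact dvd_add hf hg
  | mul_X f i hf =>
    have hX : (X i : PS K ℓ) = linP (Pi.single i 1) := by
      simp [linP, Pi.single_apply]
    have h1 : linP c0 ∣ (X i : PS K ℓ) - pullPoly s.r (pullPoly e (X i)) := by
      rw [hX, pullPoly_linP, pullPoly_linP, sub_eq_add_neg, ← neg_one_smul K]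
      have h2 := s.pullForm_r_pullForm (Pi.single i 1)
      have h3 : linP (Pi.single i 1 - pullForm s.r (pullForm e (Pi.single i 1))) =
        linP (Pi.single i 1) - linP (pullForm s.r (pullForm e (Pi.single i 1))) := by
        rw [eq_sub_iff_add_eq, ← linP_add, sub_add_cancel]
      rw [h2, linP_smul] at h3
      rw [neg_one_smul, ← sub_eq_add_neg, ← h3]
      exact dvd_mul_left _ _
    rw [map_mul, map_mul]
    have : f * X i - pullPoly s.r (pullPoly e f) * pullPoly s.r (pullPoly e (X i)) =
      (f - pullPoly s.r (pullPoly e f)) * X i +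
      pullPoly s.r (pullPoly e f) * (X i - pullPoly s.r (pullPoly e (X i))) := by ring
    rw [this]
    exact dvd_add (hf.mul_right _) (h1.mul_left _)

theorem HypSplit.linP_dvd_of_pullPoly_eq_zero (s : HypSplit c0 e) {f : PS K ℓ}
    (hf : pullPoly e f = 0) :
    linP c0 ∣ f := by
  simpa [hf] using s.linP_dvd_sub f

theorem HypSplit.pullPoly_surjective (s : HypSplit c0 e) : Function.Surjective (pullPoly e) :=
  fun f => ⟨_, s.pullPoly_pullPoly_r f⟩

theorem HypSplit.pullPoly_c0 (s : HypSplit c0 e) : pullPoly e (linP c0) = 0 := by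
  rw [pullPoly_linP, s.pullForm_c0, linP_zero]

theorem HypSplit.c0_ne_zero (s : HypSplit c0 e) : c0 ≠ 0 := by
  rintro rfl
  simpa using s.c0_v

theorem HypSplit.pullExt_dP_c0 (s : HypSplit c0 e) : pullExt e (dP c0) = 0 := by
  rw [pullExt_dP, s.pullForm_c0, ← zero_smul K (0 : Fin n → K), dP_smul, map_zero, zero_smul]

/-- Modulo the defining form of the hyperplane, the wedge product with its differential only
depends on the restriction to the hyperplane. -/
theorem HypSplit.formDvd_dP_mul_sub (s : HypSplit c0 e) (x : ExtF K ℓ) :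
    FormDvd (linP c0) (dP c0 * (x - pullExt s.r (pullExt e x))) := by
  induction x using extF_induction with
  | hC f =>
    rw [pullExt_algebraMap, pullExt_algebraMap, ← map_sub, ← Algebra.commutes, ← Algebra.smul_def]
    exact FormDvd.smul_of_dvd (s.linP_dvd_sub f) _
  | hd c =>
    have h2 := s.pullForm_r_pullForm c
    have h3 : dP c - dP (pullForm s.r (pullForm e c)) = dP ((∑ j, c j * s.v j) • c0) := by
      rw [sub_eq_iff_eq_add, ← dP_add, ← h2, sub_add_cancel]
    rw [pullExt_dP, pullExt_dP, h3, dP_smul, mul_smul_comm, dP_mul_self, smul_zero]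
    exact FormDvd.zero _
  | hmul x y hx hy =>
    rw [map_mul, map_mul]
    set x' := pullExt s.r (pullExt e x)
    set y' := pullExt s.r (pullExt e y)
    have : dP c0 * (x * y - x' * y') = dP c0 * (x - x') * y' +
        CliffordAlgebra.involute x * (dP c0 * (y - y')) := by
      have hc : CliffordAlgebra.involute x * dP c0 = dP c0 * x := (ι_mul_involute _ x).symm
      rw [← mul_assoc (CliffordAlgebra.involute x), hc]
      noncomm_ring
    rw [this]
    exact (hx.mul_right _).add (hy.mul_left _)
  | hadd x y hx hy =>
    rw [map_add, map_add, add_sub_add_comm, mul_add]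
    exact hx.add hy

theorem HypSplit.formDvd_dP_mul (s : HypSplit c0 e) {x : ExtF K ℓ} (hx : pullExt e x = 0) :
    FormDvd (linP c0) (dP c0 * x) := by
  simpa [hx] using s.formDvd_dP_mul_sub x

/-- A vector field that is tangent to the hyperplane restricts to it. -/
theorem HypSplit.exists_restrict (s : HypSplit c0 e) (d : Module.Dual (PS K ℓ) (Fin ℓ → PS K ℓ))
    (hd : pullPoly e (d fun i => C (c0 i)) = 0) :
    ∃ d' : Module.Dual (PS K n) (Fin n → PS K n),
      ∀ c : Fin ℓ → K, pullPoly e (d fun i => C (c i)) = d' fun i => C (pullForm e c i) := by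
  let w : Fin n → PS K n := fun i => pullPoly e (d fun k => C (pullForm s.r (Pi.single i 1) k))
  have hsum : ∀ c : Fin ℓ → K, pullPoly e (d fun i => C (c i)) =
      ∑ j, C (c j) * pullPoly e (d fun i => C ((Pi.single j 1 : Fin ℓ → K) i)) := by
    intro c
    have : (fun i => C (c i) : Fin ℓ → PS K ℓ) =
        ∑ j, (C (c j) : PS K ℓ) • fun i => C ((Pi.single j 1 : Fin ℓ → K) i) := by
      ext1 i
      rw [Finset.sum_apply]
      simp only [Pi.smul_apply, smul_eq_mul, ← map_mul]
      rw [← map_sum]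
      simp [Pi.single_apply]
    rw [this]
    simp only [map_sum, map_smul, smul_eq_mul, map_mul, pullPoly_C]
  refine ⟨∑ i, w i • LinearMap.proj i, fun c => ?_⟩
  have h2 := s.pullForm_r_pullForm c
  have h3 : (fun i => C (c i) : Fin ℓ → PS K ℓ) =
      (fun i => C (pullForm s.r (pullForm e c) i)) +
      (C (∑ j, c j * s.v j) : PS K ℓ) • fun i => C (c0 i) := by
    ext1 i
    have := congrFun h2 i
    simp only [Pi.sub_apply, Pi.smul_apply, smul_eq_mul] at this
    simp only [Pi.add_apply, Pi.smul_apply, smul_eq_mul, ← map_mul, ← map_add]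
    rw [← this, add_sub_cancel]
  rw [h3, map_add, map_add, map_smul, smul_eq_mul, map_mul, hd, mul_zero, add_zero, hsum]
  simp only [LinearMap.sum_apply, LinearMap.smul_apply, LinearMap.proj_apply, smul_eq_mul, w]
  have h4 : ∀ i, pullPoly e (d fun k => C (pullForm s.r (Pi.single i 1) k)) =
      ∑ j, C (pullForm s.r (Pi.single i 1) j) *
        pullPoly e (d fun i => C ((Pi.single j 1 : Fin ℓ → K) i)) := fun i => hsum _
  simp only [h4, Finset.sum_mul]
  rw [Finset.sum_comm]
  refine Finset.sum_congr rfl fun j _ => ?_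
  rw [pullForm_eq_sum, map_sum, Finset.sum_mul]
  refine Finset.sum_congr rfl fun i _ => ?_
  rw [map_mul]
  ring

end Hyperplane

section Logarithmic

variable {n : ℕ}

theorem mem_Omega_iff {A : Arrangement K ℓ} {m : (Fin ℓ → K) → ℕ} {p : ℕ} {η : ExtF K ℓ} :
    η ∈ Omega A m p ↔ η ∈ formsP K ℓ p ∧ ∀ c ∈ A.hyps, FormDvd (linP c ^ m c) (dP c * η) := by
  simp only [Omega, Submodule.mem_inf, Submodule.mem_iInf, Submodule.mem_comap,
    LinearMap.mulLeft_apply, Submodule.mem_map, LinearMap.lsmul_apply]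
  refine and_congr_right fun hη => forall₂_congr fun c hc => ?_
  constructor
  · rintro ⟨z, -, hz⟩
    exact ⟨z, hz.symm⟩
  · rintro ⟨z, hz⟩
    refine ⟨z, mem_formsP_of_smul_mem (pow_ne_zero (m c) (linP_ne_zero (A.ne_zero c hc))) ?_,
      hz.symm⟩
    rw [← hz]
    exact ι_mul_mem_formsP _ hη

theorem mem_Omega_one_iff {A : Arrangement K ℓ} {p : ℕ} {η : ExtF K ℓ} :
    η ∈ Omega A (fun _ => 1) p ↔
      η ∈ formsP K ℓ p ∧ ∀ c ∈ A.hyps, FormDvd (linP c) (dP c * η) := by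
  simp only [mem_Omega_iff, pow_one]

/-- The vector field with coefficients `g`, as a functional on one-forms. -/
def vecDual (g : Fin ℓ → PS K ℓ) : Module.Dual (PS K ℓ) (Fin ℓ → PS K ℓ) :=
  ∑ i, g i • LinearMap.proj i

theorem vecDual_apply (g a : Fin ℓ → PS K ℓ) : vecDual g a = ∑ i, g i * a i := by
  simp [vecDual, LinearMap.sum_apply]

/-- The Euler vector field. -/
def eulerDual (K : Type) [Field K] (ℓ : ℕ) : Module.Dual (PS K ℓ) (Fin ℓ → PS K ℓ) :=
  vecDual fun i => X i

theorem eulerDual_C (c : Fin ℓ → K) : eulerDual K ℓ (fun i => C (c i)) = linP c := by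
  rw [eulerDual, vecDual_apply, linP]
  exact Finset.sum_congr rfl fun i _ => mul_comm _ _

/-- The constant vector field `v`. -/
def constDual (v : Fin ℓ → K) : Module.Dual (PS K ℓ) (Fin ℓ → PS K ℓ) :=
  vecDual fun i => C (v i)

theorem constDual_C (v c : Fin ℓ → K) :
    constDual v (fun i => C (c i)) = C (∑ i, c i * v i) := by
  rw [constDual, vecDual_apply, map_sum]
  refine Finset.sum_congr rfl fun i _ => ?_
  rw [map_mul, mul_comm]

theorem exists_hypSplit {c0 : Fin ℓ → K} (hc0 : c0 ≠ 0) {e : (Fin n → K) →ₗ[K] (Fin ℓ → K)}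
    (he : Function.Injective e) (hr : LinearMap.range e = LinearMap.ker (dotLin c0)) :
    Nonempty (HypSplit c0 e) := by
  have hdot : ∀ x, dotLin c0 x = ∑ j, c0 j * x j := by
    intro x
    simp [dotLin, LinearMap.sum_apply]
  obtain ⟨j, hj⟩ : ∃ j, c0 j ≠ 0 := by
    by_contra! h
    exact hc0 (funext h)
  obtain ⟨v, hv⟩ : ∃ v : Fin ℓ → K, ∑ i, c0 i * v i = 1 :=
    ⟨Pi.single j (c0 j)⁻¹, by simp [Pi.single_apply, hj]⟩
  obtain ⟨r, hr'⟩ := LinearMap.exists_leftInverse_of_injective e (LinearMap.ker_eq_bot.2 he)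
  have hre : ∀ y, r (e y) = y := fun y => LinearMap.congr_fun hr' y
  have hker : ∀ y, ∑ j, c0 j * e y j = 0 := by
    intro y
    rw [← hdot]
    have : e y ∈ LinearMap.ker (dotLin c0) := hr ▸ LinearMap.mem_range_self e y
    exact this
  refine ⟨⟨r ∘ₗ (LinearMap.id - (dotLin c0).smulRight v), v, ?_, hv, ?_, hker⟩⟩
  · intro y
    simp [hdot, hker, hre]
  · intro x
    have : x - (dotLin c0 x) • v ∈ LinearMap.range e := by
      rw [hr, LinearMap.mem_ker, map_sub, map_smul, hdot v, hv, smul_eq_mul, mul_one, sub_self]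
    obtain ⟨y, hy⟩ := this
    simp only [LinearMap.comp_apply, LinearMap.sub_apply, LinearMap.id_apply,
      LinearMap.smulRight_apply]
    rw [← hy, hre, hy, hdot, sub_add_cancel]

theorem exists_linearMap_of_formDvd {M : Type} [AddCommGroup M] [Module (PS K ℓ) M]
    {a : PS K ℓ} (ha : a ≠ 0) (g : M →ₗ[PS K ℓ] ExtF K ℓ) (hg : ∀ x, FormDvd a (g x)) :
    ∃ h : M →ₗ[PS K ℓ] ExtF K ℓ, ∀ x, g x = a • h x := by
  choose h hh using hg
  have inj := smul_right_injective (ExtF K ℓ) ha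
  refine ⟨⟨⟨h, fun x y => inj ?_⟩, fun f x => inj ?_⟩, hh⟩
  · simp only [smul_add, ← hh, map_add]
  · simp only [RingHom.id_apply]
    rw [smul_comm, ← hh, ← hh, map_smul]

end Logarithmic

section Residue

variable {n : ℕ} {c0 : Fin ℓ → K} {e : (Fin n → K) →ₗ[K] (Fin ℓ → K)}

variable (c0 e) in
/-- `u` is the residue along `c₀ = 0` of the form `η / c₀`, restricted by `e`. -/
def IsRes (η : ExtF K ℓ) (u : ExtF K n) : Prop :=
  ∃ ζ, dP c0 * η = linP c0 • (dP c0 * ζ) ∧ pullExt e ζ = u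

theorem IsRes.add {η η' : ExtF K ℓ} {u u' : ExtF K n} (h : IsRes c0 e η u)
    (h' : IsRes c0 e η' u') : IsRes c0 e (η + η') (u + u') := by
  obtain ⟨ζ, h, rfl⟩ := h
  obtain ⟨ζ', h', rfl⟩ := h'
  exact ⟨ζ + ζ', by rw [mul_add, h, h', mul_add, smul_add], map_add _ _ _⟩

theorem IsRes.smul {η : ExtF K ℓ} {u : ExtF K n} (f : PS K ℓ) (h : IsRes c0 e η u) :
    IsRes c0 e (f • η) (pullPoly e f • u) := by
  obtain ⟨ζ, h, rfl⟩ := h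
  exact ⟨f • ζ, by rw [mul_smul_comm, h, mul_smul_comm, smul_comm], pullExt_smul _ _ _⟩

theorem HypSplit.contr_v (s : HypSplit c0 e) (x : ExtF K ℓ) :
    contr (constDual s.v) (dP c0 * x) = x - dP c0 * contr (constDual s.v) x := by
  rw [contr_dP_mul, constDual_C, s.c0_v, C_1, one_smul]

theorem HypSplit.pullExt_contr_v (s : HypSplit c0 e) (x : ExtF K ℓ) :
    pullExt e (contr (constDual s.v) (dP c0 * x)) = pullExt e x := by
  rw [s.contr_v, map_sub, map_mul, s.pullExt_dP_c0, zero_mul, sub_zero]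

theorem HypSplit.linP_c0_ne_zero (s : HypSplit c0 e) : linP c0 ≠ 0 := linP_ne_zero s.c0_ne_zero

theorem HypSplit.isRes_iff (s : HypSplit c0 e) {η : ExtF K ℓ} {u : ExtF K n} :
    IsRes c0 e η u ↔
      ∃ ξ, dP c0 * η = linP c0 • ξ ∧ pullExt e (contr (constDual s.v) ξ) = u := by
  constructor
  · rintro ⟨ζ, h, rfl⟩
    exact ⟨_, h, s.pullExt_contr_v ζ⟩
  · rintro ⟨ξ, h, rfl⟩
    refine ⟨_, ?_, rfl⟩
    have h1 : dP c0 * ξ = 0 := by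
      have : linP c0 • (dP c0 * ξ) = 0 := by
        rw [← mul_smul_comm, ← h, ← mul_assoc, dP_mul_self, zero_mul]
      exact (smul_eq_zero.1 this).resolve_left s.linP_c0_ne_zero
    have h2 := s.contr_v ξ
    rw [h1, map_zero, eq_comm, sub_eq_zero] at h2
    rw [h, ← h2]

theorem IsRes.unique (s : HypSplit c0 e) {η : ExtF K ℓ} {u u' : ExtF K n} (h : IsRes c0 e η u)
    (h' : IsRes c0 e η u') : u = u' := by
  obtain ⟨ξ, hξ, rfl⟩ := s.isRes_iff.1 h
  obtain ⟨ξ', hξ', rfl⟩ := s.isRes_iff.1 h'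
  rw [smul_right_injective _ s.linP_c0_ne_zero (hξ.symm.trans hξ')]

theorem HypSplit.exists_isRes (s : HypSplit c0 e) {η : ExtF K ℓ}
    (h : FormDvd (linP c0) (dP c0 * η)) : ∃ u, IsRes c0 e η u := by
  obtain ⟨ξ, h⟩ := h
  exact ⟨_, s.isRes_iff.2 ⟨ξ, h, rfl⟩⟩

theorem IsRes.mem_formsP (s : HypSplit c0 e) {p : ℕ} {η : ExtF K ℓ} {u : ExtF K n}
    (h : IsRes c0 e η u) (hη : η ∈ formsP K ℓ p) : u ∈ formsP K n p := by
  obtain ⟨ξ, hξ, rfl⟩ := s.isRes_iff.1 h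
  refine pullExt_mem_formsP e (contr_mem_formsP _ (mem_formsP_of_smul_mem s.linP_c0_ne_zero ?_))
  rw [← hξ]
  exact ι_mul_mem_formsP _ hη

theorem IsRes.exists_eq_smul (s : HypSplit c0 e) {η : ExtF K ℓ} (h : IsRes c0 e η 0) :
    ∃ ζ, dP c0 * η = linP c0 • (linP c0 • (dP c0 * ζ)) := by
  obtain ⟨ζ, h, h0⟩ := h
  obtain ⟨ξ, hξ⟩ := s.formDvd_dP_mul h0
  obtain ⟨ζ', h', -⟩ := s.isRes_iff.2 ⟨ξ, hξ, rfl⟩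
  exact ⟨ζ', by rw [h, h']⟩

end Residue

section ResidueModules

variable {n : ℕ} {c0 : Fin ℓ → K} {e : (Fin n → K) →ₗ[K] (Fin ℓ → K)}

variable (c0 e) in
/-- The forms of `A`, other than `c0`, with the same restriction as `c` up to scalars. -/
def restrClass (A : Arrangement K ℓ) (c : Fin ℓ → K) : Finset (Fin ℓ → K) :=
  A.hyps.filter fun c' => c' ≠ c0 ∧ ∃ t : K, t ≠ 0 ∧ pullForm e c' = t • pullForm e c

variable (c0 e) in
/-- The forms on the hyperplane that satisfy the divisibility conditions of the Ziegler
restriction. -/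
def zieglerModule (A : Arrangement K ℓ) (p : ℕ) : Submodule (PS K n) (ExtF K n) where
  carrier := {u | u ∈ formsP K n p ∧ ∀ c ∈ A.hyps, c ≠ c0 →
    FormDvd (∏ c' ∈ restrClass c0 e A c, linP (pullForm e c')) (dP (pullForm e c) * u)}
  add_mem' := fun hu hv => ⟨add_mem hu.1 hv.1, fun c hc h => by
    rw [mul_add]
    exact (hu.2 c hc h).add (hv.2 c hc h)⟩
  zero_mem' := ⟨zero_mem _, fun c _ _ => by
    rw [mul_zero]
    exact FormDvd.zero _⟩
  smul_mem' := fun f u hu => ⟨Submodule.smul_mem _ f hu.1, fun c hc h => by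
    rw [mul_smul_comm]
    exact (hu.2 c hc h).smul f⟩

theorem mem_zieglerModule_iff {A : Arrangement K ℓ} {p : ℕ} {u : ExtF K n} :
    u ∈ zieglerModule c0 e A p ↔ u ∈ formsP K n p ∧ ∀ c ∈ A.hyps, c ≠ c0 →
      FormDvd (∏ c' ∈ restrClass c0 e A c, linP (pullForm e c')) (dP (pullForm e c) * u) := Iff.rfl

/-- The residues of the logarithmic forms of `A` along the hyperplane of `c0`. -/
def HypSplit.resModule (s : HypSplit c0 e) (A : Arrangement K ℓ) (p : ℕ) :
    Submodule (PS K n) (ExtF K n) where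
  carrier := {u | ∃ η ∈ Omega A (fun _ => 1) p, IsRes c0 e η u}
  add_mem' := by
    rintro u u' ⟨η, hη, h⟩ ⟨η', hη', h'⟩
    exact ⟨η + η', add_mem hη hη', h.add h'⟩
  zero_mem' := ⟨0, zero_mem _, 0, by simp, map_zero _⟩
  smul_mem' := by
    rintro f u ⟨η, hη, h⟩
    refine ⟨pullPoly s.r f • η, Submodule.smul_mem _ _ hη, ?_⟩
    have := h.smul (pullPoly s.r f)
    rwa [s.pullPoly_pullPoly_r] at this

theorem HypSplit.exists_eq_of_pullForm_eq (s : HypSplit c0 e) {c c' : Fin ℓ → K} {t : K}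
    (h : pullForm e c' = t • pullForm e c) : ∃ a : K, c' = t • c + a • c0 := by
  have h1 := s.pullForm_r_pullForm (c' - t • c)
  have h2 : pullForm e (c' - t • c) = 0 := by
    rw [sub_eq_add_neg, ← neg_one_smul K, pullForm_add, pullForm_smul, pullForm_smul, h]
    simp
  rw [h2] at h1
  have h3 : pullForm s.r 0 = 0 := by
    have := pullForm_smul s.r 0 0
    simpa using this
  rw [h3, sub_zero] at h1
  exact ⟨_, by rw [← h1, add_sub_cancel]⟩

theorem HypSplit.pullForm_ne_zero (s : HypSplit c0 e) {A : Arrangement K ℓ} (hc0 : c0 ∈ A.hyps)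
    {c : Fin ℓ → K} (hc : c ∈ A.hyps) (h : c ≠ c0) : pullForm e c ≠ 0 := by
  intro h0
  obtain ⟨a, ha⟩ := s.exists_eq_of_pullForm_eq (c := 0) (t := 0) (h0.trans (zero_smul _ _).symm)
  rw [smul_zero, zero_add] at ha
  exact A.nonprop c hc c0 hc0 h a ha

theorem Arrangement.linP_isRelPrime (A : Arrangement K ℓ) {c d : Fin ℓ → K} (hc : c ∈ A.hyps)
    (hd : d ∈ A.hyps) (h : c ≠ d) : IsRelPrime (linP c) (linP d) :=
  _root_.linP_isRelPrime (A.ne_zero c hc) (A.ne_zero d hd) (A.nonprop c hc d hd h)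

theorem HypSplit.resModule_le (s : HypSplit c0 e) {A : Arrangement K ℓ} (hc0 : c0 ∈ A.hyps)
    (p : ℕ) : s.resModule A p ≤ zieglerModule c0 e A p := by
  rintro _ ⟨η, hη, h⟩
  rw [mem_Omega_one_iff] at hη
  refine ⟨h.mem_formsP s hη.1, fun c hc hcc0 => ?_⟩
  obtain ⟨ζ, h, rfl⟩ := h
  have key : FormDvd (∏ c' ∈ restrClass c0 e A c, linP c') (dP c0 * (dP c * ζ)) := by
    refine formDvd_prod _ linP (fun i hi j hj hij => A.linP_isRelPrime
      (Finset.mem_filter.1 hi).1 (Finset.mem_filter.1 hj).1 hij) fun c' hc' => ?_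
    obtain ⟨hc', hne, t, ht, htt⟩ := Finset.mem_filter.1 hc'
    refine FormDvd.of_smul_isRelPrime (A.linP_isRelPrime hc' hc0 hne) ?_
    have h1 : linP c0 • (dP c0 * (dP c * ζ)) = dP c0 * (dP c * η) := by
      rw [← mul_assoc, dP_mul_comm, neg_mul, smul_neg, mul_assoc, ← mul_smul_comm, ← h,
        ← mul_assoc (dP c0), dP_mul_comm c0, neg_mul, mul_assoc]
    obtain ⟨a, ha⟩ := s.exists_eq_of_pullForm_eq htt
    have h2 : dP c0 * (dP c * η) = (C t⁻¹ : PS K ℓ) • (dP c0 * (dP c' * η)) := by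
      rw [ha, dP_add, dP_smul, dP_smul, add_mul, mul_add, smul_mul_assoc, smul_mul_assoc,
        mul_smul_comm, mul_smul_comm, ← mul_assoc (dP c0) (dP c0), dP_mul_self, zero_mul,
        smul_zero, add_zero, smul_smul, ← C_mul, inv_mul_cancel₀ ht, C_1, one_smul]
    rw [h1, h2]
    exact ((hη.2 c' hc').mul_left _).smul _
  obtain ⟨κ, hκ⟩ := key
  have h3 := s.pullExt_contr_v (dP c * ζ)
  rw [hκ, map_smul, pullExt_smul, map_prod, map_mul, pullExt_dP] at h3
  simp only [pullPoly_linP] at h3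
  exact ⟨_, h3.symm⟩

/-- The logarithmic forms of `A` that are annihilated by contraction with the Euler field. -/
def omegaZero (A : Arrangement K ℓ) (p : ℕ) : Submodule (PS K ℓ) (ExtF K ℓ) :=
  Omega A (fun _ => 1) p ⊓ LinearMap.ker (contr (eulerDual K ℓ))

/-- Dividing the Euler contraction of `dc0 ∧ η` by `c0` projects the logarithmic forms onto the
ones that the Euler contraction annihilates, without changing the product with `dc0`. -/
theorem exists_projection_omegaZero {A : Arrangement K ℓ} (hc0 : c0 ∈ A.hyps) (p : ℕ) :
    ∃ r : Omega A (fun _ => 1) p →ₗ[PS K ℓ] omegaZero A p,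
      (∀ η, dP c0 * (r η : ExtF K ℓ) = dP c0 * (η : ExtF K ℓ)) ∧
      ∀ η (h : η ∈ omegaZero A p), r ⟨η, h.1⟩ = ⟨η, h⟩ := by
  have hα : linP c0 ≠ 0 := linP_ne_zero (A.ne_zero c0 hc0)
  obtain ⟨g, hg⟩ := exists_linearMap_of_formDvd hα
    (contr (eulerDual K ℓ) ∘ₗ LinearMap.mulLeft (PS K ℓ) (dP c0) ∘ₗ
      (Omega A (fun _ => 1) p).subtype) (fun η =>
        ((mem_Omega_one_iff.1 η.2).2 c0 hc0).map (contr (eulerDual K ℓ)))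
  simp only [LinearMap.comp_apply, LinearMap.mulLeft_apply, Submodule.subtype_apply] at hg
  have h1 : ∀ η, dP c0 * g η = dP c0 * (η : ExtF K ℓ) := by
    intro η
    refine smul_right_injective _ hα ?_
    beta_reduce
    rw [← mul_smul_comm, ← hg, contr_dP_mul, eulerDual_C, mul_sub, ← mul_assoc (dP c0) (dP c0),
      dP_mul_self, zero_mul, sub_zero, mul_smul_comm]
  have h2 : ∀ η, g η ∈ omegaZero A p := by
    intro η
    obtain ⟨hf, hd⟩ := mem_Omega_one_iff.1 η.2
    refine ⟨mem_Omega_one_iff.2 ⟨?_, fun c hc => ?_⟩, ?_⟩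
    · refine mem_formsP_of_smul_mem hα ?_
      rw [← hg]
      exact contr_mem_formsP _ (ι_mul_mem_formsP _ hf)
    · by_cases h : c = c0
      · rw [h, h1]
        exact hd c0 hc0
      · refine FormDvd.of_smul_isRelPrime (A.linP_isRelPrime hc hc0 h) ?_
        have h3 : linP c0 • (dP c * g η) =
            linP c • (dP c0 * (η : ExtF K ℓ)) +
              contr (eulerDual K ℓ) (dP c0 * (dP c * (η : ExtF K ℓ))) := by
          rw [← mul_smul_comm, ← hg, ← mul_assoc, dP_mul_comm c0 c, neg_mul, map_neg, mul_assoc,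
            contr_dP_mul _ c, eulerDual_C]
          abel
        rw [h3]
        exact (FormDvd.smul_of_dvd dvd_rfl _).add (((hd c hc).mul_left _).map _)
    · refine smul_right_injective _ hα ?_
      beta_reduce
      rw [← map_smul, ← hg, contr_contr, smul_zero]
  refine ⟨g.codRestrict _ h2, h1, fun η h => Subtype.ext ?_⟩
  refine smul_right_injective _ hα ?_
  change linP c0 • g ⟨η, h.1⟩ = linP c0 • η
  have h3 : contr (eulerDual K ℓ) η = 0 := h.2
  rw [← hg, contr_dP_mul, eulerDual_C, h3, mul_zero, sub_zero]

theorem HypSplit.pdLE_resModule (s : HypSplit c0 e) {A : Arrangement K ℓ} (hc0 : c0 ∈ A.hyps)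
    {p d : ℕ} (h : pdLE (PS K ℓ) d (Omega A (fun _ => 1) p)) :
    pdLE (PS K n) d (s.resModule A p) := by
  obtain ⟨r, hr, hr'⟩ := exists_projection_omegaZero hc0 p
  have h0 : pdLE (PS K ℓ) d (omegaZero A p) := by
    refine pdLE_of_retract (Submodule.inclusion inf_le_left) r ?_ h
    ext1 η
    exact hr' η.1 η.2
  have hα := s.linP_c0_ne_zero
  have hex : ∀ η : omegaZero A p, ∃ u : s.resModule A p, IsRes c0 e (η : ExtF K ℓ) u := by
    intro η
    obtain ⟨u, hu⟩ := s.exists_isRes ((mem_Omega_one_iff.1 η.2.1).2 c0 hc0)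
    exact ⟨⟨u, η, η.2.1, hu⟩, hu⟩
  choose f hf using hex
  let F : omegaZero A p →ₛₗ[(pullPoly e : PS K ℓ →+* PS K n)] s.resModule A p :=
    { toFun := f
      map_add' := fun η η' => Subtype.ext ((hf (η + η')).unique s ((hf η).add (hf η')))
      map_smul' := fun a η => Subtype.ext ((hf (a • η)).unique s ((hf η).smul a)) }
  refine pdLE_of_semilinear (pullPoly e : PS K ℓ →+* PS K n) s.pullPoly_surjective (linP c0) hα
    (fun f hf => s.linP_dvd_of_pullPoly_eq_zero hf) s.pullPoly_c0 d _ _ F ?_ ?_ ?_ h0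
  · rintro ⟨u, η, hη, hu⟩
    refine ⟨r ⟨η, hη⟩, Subtype.ext ((hf (r ⟨η, hη⟩)).unique s ?_)⟩
    obtain ⟨ζ, h, rfl⟩ := hu
    exact ⟨ζ, by rw [hr, h], rfl⟩
  · intro η hη
    have h1 := hf η
    have h2 : f η = 0 := hη
    rw [h2] at h1
    obtain ⟨ζ, hζ⟩ := h1.exists_eq_smul s
    have h3 : contr (eulerDual K ℓ) (η : ExtF K ℓ) = 0 := η.2.2
    have h4 : (η : ExtF K ℓ) = linP c0 • contr (eulerDual K ℓ) (dP c0 * ζ) := by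
      refine smul_right_injective _ hα ?_
      have := congrArg (contr (eulerDual K ℓ)) hζ
      rw [contr_dP_mul, eulerDual_C, h3, mul_zero, sub_zero, map_smul, map_smul] at this
      exact this
    have h5 : dP c0 * contr (eulerDual K ℓ) (dP c0 * ζ) = linP c0 • (dP c0 * ζ) := by
      rw [contr_dP_mul, eulerDual_C, mul_sub, ← mul_assoc (dP c0) (dP c0), dP_mul_self, zero_mul,
        sub_zero, mul_smul_comm]
    refine ⟨⟨contr (eulerDual K ℓ) (dP c0 * ζ), ⟨mem_Omega_one_iff.2 ⟨?_, fun c hc => ?_⟩, ?_⟩⟩,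
      Subtype.ext h4⟩
    · refine mem_formsP_of_smul_mem hα ?_
      rw [← h4]
      exact (mem_Omega_one_iff.1 η.2.1).1
    · by_cases h : c = c0
      · rw [h, h5]
        exact FormDvd.smul_of_dvd dvd_rfl _
      · refine FormDvd.of_smul_isRelPrime (A.linP_isRelPrime hc hc0 h) ?_
        rw [← mul_smul_comm, ← h4]
        exact (mem_Omega_one_iff.1 η.2.1).2 c hc
    · exact contr_contr _ _
  · intro η hη
    exact (smul_eq_zero.1 hη).resolve_left hα

end ResidueModules

section Frame

variable {n : ℕ}

theorem contr_sum_smul {I : Type} (t : Finset I) (a : I → PS K ℓ)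
    (d : I → Module.Dual (PS K ℓ) (Fin ℓ → PS K ℓ)) (x : ExtF K ℓ) :
    contr (∑ i ∈ t, a i • d i) x = ∑ i ∈ t, a i • contr (d i) x := by
  simp only [contr, map_sum, map_smul, LinearMap.sum_apply, LinearMap.smul_apply]

theorem contr_sub_smul (a b : PS K ℓ) (d d' : Module.Dual (PS K ℓ) (Fin ℓ → PS K ℓ))
    (x : ExtF K ℓ) : contr (a • d - b • d') x = a • contr d x - b • contr d' x := by
  simp only [contr, map_sub, map_smul, LinearMap.sub_apply, LinearMap.smul_apply]

theorem contr_dP (d : Module.Dual (PS K ℓ) (Fin ℓ → PS K ℓ)) (c : Fin ℓ → K) :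
    contr d (dP c) = algebraMap _ _ (d fun i => C (c i)) := contr_ι d _

theorem dvd_of_formDvd_algebraMap {a f : PS K ℓ} (h : FormDvd a (algebraMap _ (ExtF K ℓ) f)) :
    a ∣ f := by
  obtain ⟨z, hz⟩ := h
  have := congrArg ExteriorAlgebra.algebraMapInv hz
  rw [ExteriorAlgebra.algebraMap_leftInverse, map_smul, smul_eq_mul] at this
  exact ⟨_, this⟩

theorem algebraMap_extF_injective : Function.Injective (algebraMap (PS K ℓ) (ExtF K ℓ)) :=
  (ExteriorAlgebra.algebraMap_leftInverse (R := PS K ℓ) (Fin ℓ → PS K ℓ)).injective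

theorem exists_dot_eq_one {c : Fin ℓ → K} (hc : c ≠ 0) : ∃ v : Fin ℓ → K, ∑ i, c i * v i = 1 := by
  obtain ⟨j, hj⟩ : ∃ j, c j ≠ 0 := by
    by_contra! h
    exact hc (funext h)
  exact ⟨Pi.single j (c j)⁻¹, by simp [Pi.single_apply, hj]⟩

theorem dvd_of_formDvd_smul_dP {a f : PS K ℓ} {c : Fin ℓ → K} (hc : c ≠ 0)
    (h : FormDvd a (f • dP c)) : a ∣ f := by
  obtain ⟨v, hv⟩ := exists_dot_eq_one hc
  have := h.map (contr (constDual v))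
  rw [map_smul, contr_dP, constDual_C, hv, Algebra.smul_def, ← map_mul, C_1, mul_one] at this
  exact dvd_of_formDvd_algebraMap this

theorem mul_algebraMap_eq_smul (x : ExtF K ℓ) (f : PS K ℓ) : x * algebraMap _ _ f = f • x := by
  rw [← Algebra.commutes, ← Algebra.smul_def]

theorem dP_mul_eq_involute_mul (c : Fin ℓ → K) (x : ExtF K ℓ) :
    dP c * x = CliffordAlgebra.involute x * dP c := ι_mul_involute _ x

/-- A wedge product of forms that restrict to zero on a hyperplane vanishes along it. -/
theorem FormDvd.mul_of_dP_mul {c : Fin ℓ → K} (hc : c ≠ 0) {x y : ExtF K ℓ}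
    (hx : FormDvd (linP c) (dP c * x)) (hy : FormDvd (linP c) (dP c * y)) :
    FormDvd (linP c) (x * y) := by
  obtain ⟨v, hv⟩ := exists_dot_eq_one hc
  have hdec : ∀ z, z = contr (constDual v) (dP c * z) + dP c * contr (constDual v) z := by
    intro z
    rw [contr_dP_mul, constDual_C, hv, C_1, one_smul, sub_add_cancel]
  have hx' := hx.map (contr (constDual v))
  have h : x * y = contr (constDual v) (dP c * x) * y +
      CliffordAlgebra.involute (contr (constDual v) x) * (dP c * y) := by
    conv_lhs => rw [hdec x]
    rw [add_mul, ← mul_assoc (CliffordAlgebra.involute _) (dP c)]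
    rw [← dP_mul_eq_involute_mul]
  rw [h]
  exact (hx'.mul_right _).add (hy.mul_left _)

/-- A basis of the logarithmic one-forms, with the coordinates of the constant one-forms and
of their Euler contractions. -/
structure LogFrame (A : Arrangement K ℓ) (c0 : Fin ℓ → K) (I : Type) [Fintype I] where
  b : I → ExtF K ℓ
  θ : I → Module.Dual (PS K ℓ) (Fin ℓ → PS K ℓ)
  f : I → PS K ℓ
  g : I → PS K ℓ
  b_mem : ∀ i, b i ∈ Omega A (fun _ => 1) 1
  θ_c0 : ∀ i, θ i (fun j => C (c0 j)) = linP c0 * f i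
  θ_dvd : ∀ i, ∀ c ∈ A.hyps, linP c ∣ θ i fun j => C (c j)
  θ_b : ∀ i j, contr (θ i) (b j) =
    algebraMap _ _ (if j = i then ∏ c ∈ A.hyps, linP c else 0)
  sum_θ : ∀ c : Fin ℓ → K, ∑ i, (θ i fun j => C (c j)) • b i = (∏ c ∈ A.hyps, linP c) • dP c
  sum_f : ∑ i, f i • b i = (∏ c ∈ A.hyps.erase c0, linP c) • dP c0
  sum_fg : ∑ i, f i * g i = 1

theorem prod_linP_ne_zero {A : Arrangement K ℓ} : ∏ c ∈ A.hyps, linP c ≠ 0 :=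
  Finset.prod_ne_zero_iff.2 fun c hc => linP_ne_zero (A.ne_zero c hc)

theorem prod_linP_smul_mem {A : Arrangement K ℓ} {p : ℕ} {x : ExtF K ℓ} (hx : x ∈ formsP K ℓ p) :
    (∏ c ∈ A.hyps, linP c) • x ∈ Omega A (fun _ => 1) p := by
  refine mem_Omega_one_iff.2 ⟨Submodule.smul_mem _ _ hx, fun c hc => ?_⟩
  rw [mul_smul_comm]
  exact FormDvd.smul_of_dvd (Finset.dvd_prod_of_mem _ hc) _

theorem prod_erase_smul_dP_mem {A : Arrangement K ℓ} (c0 : Fin ℓ → K) :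
    (∏ c ∈ A.hyps.erase c0, linP c) • dP c0 ∈ Omega A (fun _ => 1) 1 := by
  refine mem_Omega_one_iff.2 ⟨Submodule.smul_mem _ _ (dP_mem_formsP _), fun c hc => ?_⟩
  rw [mul_smul_comm]
  by_cases h : c = c0
  · rw [h, dP_mul_self, smul_zero]
    exact FormDvd.zero _
  · exact FormDvd.smul_of_dvd (Finset.dvd_prod_of_mem _ (Finset.mem_erase.2 ⟨h, hc⟩)) _

theorem formDvd_dP_mul_contr_euler {c : Fin ℓ → K} {x : ExtF K ℓ}
    (h : FormDvd (linP c) (dP c * x)) :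
    FormDvd (linP c) (dP c * contr (eulerDual K ℓ) x) := by
  have := h.map (contr (eulerDual K ℓ))
  rw [contr_dP_mul, eulerDual_C] at this
  have h2 := (FormDvd.smul_of_dvd (dvd_refl (linP c)) x).sub this
  rwa [sub_sub_cancel] at h2

theorem prod_dvd_of_forall_dvd {A : Arrangement K ℓ} {f : PS K ℓ}
    (h : ∀ c ∈ A.hyps, linP c ∣ f) : ∏ c ∈ A.hyps, linP c ∣ f :=
  Finset.prod_dvd_of_isRelPrime
    (fun _ hi _ hj hij => A.linP_isRelPrime hi hj hij) h

theorem exists_logFrame {A : Arrangement K ℓ} {c0 : Fin ℓ → K} (hc0 : c0 ∈ A.hyps)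
    (hA : FreeM A fun _ => 1) : ∃ (I : Type) (_ : Fintype I), Nonempty (LogFrame A c0 I) := by
  have _ : Module.Free (PS K ℓ) (Omega A (fun _ => 1) 1) := hA
  let I := Module.Free.ChooseBasisIndex (PS K ℓ) (Omega A (fun _ => 1) 1)
  let b := Module.Free.chooseBasis (PS K ℓ) (Omega A (fun _ => 1) 1)
  let J : (Fin ℓ → PS K ℓ) →ₗ[PS K ℓ] Omega A (fun _ => 1) 1 :=
    LinearMap.codRestrict _ ((∏ c ∈ A.hyps, linP c) • ExteriorAlgebra.ι (PS K ℓ))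
      fun a => prod_linP_smul_mem (ι_mem_formsP a)
  have hJ : ∀ a, (J a : ExtF K ℓ) = (∏ c ∈ A.hyps, linP c) • ExteriorAlgebra.ι (PS K ℓ) a :=
    fun a => rfl
  let ω : (Fin ℓ → K) → Omega A (fun _ => 1) 1 := fun c => ⟨_, prod_erase_smul_dP_mem c⟩
  have hω : ∀ c ∈ A.hyps, J (fun j => C (c j)) = linP c • ω c := by
    intro c hc
    refine Subtype.ext ?_
    rw [hJ, ← Finset.mul_prod_erase _ _ hc, mul_smul]
    rfl
  have hsum : ∀ x : Omega A (fun _ => 1) 1, ∑ i, b.coord i x • (b i : ExtF K ℓ) = x := by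
    intro x
    conv_rhs => rw [← b.sum_repr x]
    simp only [Submodule.coe_sum, Submodule.coe_smul]
    rfl
  have hg : ∀ i, ∃ g, contr (eulerDual K ℓ) (b i : ExtF K ℓ) =
      algebraMap _ _ ((∏ c ∈ A.hyps, linP c) * g) := by
    intro i
    obtain ⟨h1, h2⟩ := mem_Omega_one_iff.1 (b i).2
    obtain ⟨g, hg⟩ := mem_formsP_zero.1 (contr_mem_formsP (eulerDual K ℓ) h1)
    obtain ⟨g', rfl⟩ : ∏ c ∈ A.hyps, linP c ∣ g := by
      refine prod_dvd_of_forall_dvd fun c hc => dvd_of_formDvd_smul_dP (A.ne_zero c hc) ?_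
      rw [← mul_algebraMap_eq_smul, ← hg]
      exact formDvd_dP_mul_contr_euler (h2 c hc)
    exact ⟨g', hg⟩
  choose g hg using hg
  refine ⟨I, inferInstance, ⟨
    { b := fun i => b i
      θ := fun i => b.coord i ∘ₗ J
      f := fun i => b.coord i (ω c0)
      g := g
      b_mem := fun i => (b i).2
      θ_c0 := fun i => ?_
      θ_dvd := fun i c hc => ?_
      θ_b := fun i j => ?_
      sum_θ := fun c => hsum _
      sum_f := hsum (ω c0)
      sum_fg := ?_ }⟩⟩
  · rw [LinearMap.comp_apply, hω c0 hc0, map_smul, smul_eq_mul]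
  · rw [LinearMap.comp_apply, hω c hc, map_smul, smul_eq_mul]
    exact dvd_mul_right _ _
  · obtain ⟨a, ha⟩ := mem_formsP_one (mem_Omega_one_iff.1 (b j).2).1
    have hJa : J a = (∏ c ∈ A.hyps, linP c) • b j := Subtype.ext (by rw [hJ, ← ha]; rfl)
    rw [ha, contr_ι, LinearMap.comp_apply, hJa, map_smul, Module.Basis.coord_apply,
      b.repr_self, Finsupp.single_apply, smul_eq_mul, mul_ite, mul_one, mul_zero]
  · have h1 := congrArg (contr (eulerDual K ℓ)) (hsum (ω c0))
    have h2 : (ω c0 : ExtF K ℓ) = (∏ c ∈ A.hyps.erase c0, linP c) • dP c0 := rfl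
    rw [h2, map_smul, contr_dP, eulerDual_C, map_sum] at h1
    simp only [map_smul, hg] at h1
    simp only [Algebra.smul_def, ← map_mul] at h1
    rw [← map_sum] at h1
    have h3 := algebraMap_extF_injective h1
    rw [Finset.prod_erase_mul _ _ hc0] at h3
    refine mul_left_cancel₀ (prod_linP_ne_zero (A := A)) ?_
    rw [mul_one, Finset.mul_sum]
    refine (Finset.sum_congr rfl fun i _ => ?_).trans h3
    ring

end Frame

section ResidueCalculus

variable {n : ℕ} {c0 : Fin ℓ → K} {e : (Fin n → K) →ₗ[K] (Fin ℓ → K)}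

theorem IsRes.contr {d : Module.Dual (PS K ℓ) (Fin ℓ → PS K ℓ)}
    {d' : Module.Dual (PS K n) (Fin n → PS K n)} (hd : d (fun i => C (c0 i)) = 0)
    (hdd' : ∀ c : Fin ℓ → K, pullPoly e (d fun i => C (c i)) = d' fun i => C (pullForm e c i))
    {η : ExtF K ℓ} {u : ExtF K n} (h : IsRes c0 e η u) :
    IsRes c0 e (contr d η) (_root_.contr d' u) := by
  obtain ⟨ζ, h, rfl⟩ := h
  refine ⟨_root_.contr d ζ, ?_, pullExt_contr e d d' hdd' ζ⟩
  have h1 := congrArg (_root_.contr d) h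
  rw [contr_dP_mul, hd, zero_smul, zero_sub, map_smul, contr_dP_mul, hd, zero_smul, zero_sub,
    smul_neg, neg_inj] at h1
  exact h1

theorem isRes_algebraMap (f : PS K ℓ) :
    IsRes c0 e (algebraMap _ _ (linP c0 * f)) (algebraMap _ _ (pullPoly e f)) :=
  ⟨algebraMap _ _ f, by rw [mul_algebraMap_eq_smul, mul_algebraMap_eq_smul, mul_smul],
    pullExt_algebraMap e f⟩

theorem dual_C_add_smul (d : Module.Dual (PS K ℓ) (Fin ℓ → PS K ℓ)) (t a : K)
    (c c' : Fin ℓ → K) : (d fun i => C ((t • c + a • c') i)) =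
      C t * (d fun i => C (c i)) + C a * d fun i => C (c' i) := by
  have : (fun i => C ((t • c + a • c') i) : Fin ℓ → PS K ℓ) =
      (C t : PS K ℓ) • (fun i => C (c i)) + (C a : PS K ℓ) • fun i => C (c' i) := by
    ext1 i
    simp
  rw [this, map_add, map_smul, map_smul, smul_eq_mul, smul_eq_mul]

theorem HypSplit.prod_restrClass_dvd (s : HypSplit c0 e) {A : Arrangement K ℓ}
    {d : Module.Dual (PS K ℓ) (Fin ℓ → PS K ℓ)} (hd : d (fun i => C (c0 i)) = 0)
    (hdA : ∀ c ∈ A.hyps, linP c ∣ d fun i => C (c i)) (c : Fin ℓ → K) :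
    ∏ c' ∈ restrClass c0 e A c, linP c' ∣ d fun i => C (c i) := by
  refine Finset.prod_dvd_of_isRelPrime (fun i hi j hj hij => A.linP_isRelPrime
      (Finset.mem_filter.1 hi).1 (Finset.mem_filter.1 hj).1 hij) fun c' hc' => ?_
  obtain ⟨hc', -, t, ht, htt⟩ := Finset.mem_filter.1 hc'
  obtain ⟨a, ha⟩ := s.exists_eq_of_pullForm_eq htt
  have h1 := hdA c' hc'
  rw [ha, dual_C_add_smul, hd, mul_zero, add_zero, ← ha] at h1
  have h2 := h1.mul_left (C t⁻¹)
  rwa [← mul_assoc, ← C_mul, inv_mul_cancel₀ ht, C_1, one_mul] at h2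

theorem HypSplit.contr_mem_zieglerModule (s : HypSplit c0 e) {A : Arrangement K ℓ}
    {d : Module.Dual (PS K ℓ) (Fin ℓ → PS K ℓ)}
    {d' : Module.Dual (PS K n) (Fin n → PS K n)} (hd : d (fun i => C (c0 i)) = 0)
    (hdA : ∀ c ∈ A.hyps, linP c ∣ d fun i => C (c i))
    (hdd' : ∀ c : Fin ℓ → K, pullPoly e (d fun i => C (c i)) = d' fun i => C (pullForm e c i))
    {p : ℕ} {u : ExtF K n} (hu : u ∈ zieglerModule c0 e A (p + 1)) :
    _root_.contr d' u ∈ zieglerModule c0 e A p := by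
  refine ⟨contr_mem_formsP _ hu.1, fun c hc h => ?_⟩
  have h1 := (hu.2 c hc h).map (_root_.contr d')
  rw [contr_dP_mul] at h1
  have h2 : ∏ c' ∈ restrClass c0 e A c, linP (pullForm e c') ∣
      d' fun i => C (pullForm e c i) := by
    rw [← hdd']
    have := map_dvd (pullPoly e) (s.prod_restrClass_dvd hd hdA c)
    simpa only [map_prod, pullPoly_linP] using this
  have h3 := (FormDvd.smul_of_dvd h2 u).sub h1
  rwa [sub_sub_cancel] at h3

theorem exists_smul_eq_mul {A : Arrangement K ℓ} {p : ℕ} {b η : ExtF K ℓ}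
    (hb : b ∈ Omega A (fun _ => 1) 1) (hη : η ∈ Omega A (fun _ => 1) p) :
    ∃ κ ∈ Omega A (fun _ => 1) (p + 1), b * η = (∏ c ∈ A.hyps, linP c) • κ := by
  obtain ⟨hb1, hb2⟩ := mem_Omega_one_iff.1 hb
  obtain ⟨hη1, hη2⟩ := mem_Omega_one_iff.1 hη
  have h0 : FormDvd (∏ c ∈ A.hyps, linP c) (b * η) :=
    formDvd_prod _ _ (fun _ hi _ hj hij => A.linP_isRelPrime hi hj hij) fun c hc =>
      FormDvd.mul_of_dP_mul (A.ne_zero c hc) (hb2 c hc) (hη2 c hc)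
  obtain ⟨κ, hκ⟩ := h0
  refine ⟨κ, mem_Omega_one_iff.2 ⟨?_, fun c hc => ?_⟩, hκ⟩
  · refine mem_formsP_of_smul_mem (prod_linP_ne_zero (A := A)) ?_
    rw [← hκ, add_comm]
    exact mul_mem_formsP hb1 hη1
  · have hcne := linP_ne_zero (A.ne_zero c hc)
    obtain ⟨β, hβ⟩ := hb2 c hc
    have h1 : dP c * β = 0 := by
      have : linP c • (dP c * β) = 0 := by
        rw [← mul_smul_comm, ← hβ, ← mul_assoc, dP_mul_self, zero_mul]
      exact (smul_eq_zero.1 this).resolve_left hcne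
    have h2 : FormDvd (linP c) (β * η) :=
      FormDvd.mul_of_dP_mul (A.ne_zero c hc) (by rw [h1]; exact FormDvd.zero _) (hη2 c hc)
    have h3 : (∏ c ∈ A.hyps.erase c, linP c) • (dP c * κ) = β * η := by
      refine smul_right_injective _ hcne ?_
      beta_reduce
      rw [smul_smul, Finset.mul_prod_erase _ _ hc, ← mul_smul_comm, ← hκ, ← mul_assoc, hβ,
        smul_mul_assoc]
    rw [← h3] at h2
    refine FormDvd.of_smul_isRelPrime (IsRelPrime.prod_right fun d hd => ?_) h2
    obtain ⟨hdc, hd⟩ := Finset.mem_erase.1 hd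
    exact A.linP_isRelPrime hc hd hdc.symm

theorem HypSplit.exists_smul_eq_mul (s : HypSplit c0 e) {A : Arrangement K ℓ} (hc0 : c0 ∈ A.hyps)
    {p : ℕ} {b : ExtF K ℓ} {w u : ExtF K n} (hb : b ∈ Omega A (fun _ => 1) 1)
    (hw : IsRes c0 e b w) (hu : u ∈ s.resModule A p) :
    ∃ y ∈ s.resModule A (p + 1),
      pullPoly e (∏ c ∈ A.hyps.erase c0, linP c) • y = w * u := by
  obtain ⟨η, hη, hu⟩ := hu
  obtain ⟨κ, hκ, hbκ⟩ := _root_.exists_smul_eq_mul hb hη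
  obtain ⟨y, hy⟩ := s.exists_isRes ((mem_Omega_one_iff.1 hκ).2 c0 hc0)
  refine ⟨y, ⟨κ, hκ, hy⟩, (hy.smul _).unique s ?_⟩
  obtain ⟨ζ, hζ, rfl⟩ := hw
  obtain ⟨ζ', hζ', rfl⟩ := hu
  refine ⟨ζ * ζ', smul_right_injective _ s.linP_c0_ne_zero ?_, map_mul _ _ _⟩
  beta_reduce
  rw [← mul_smul_comm, smul_smul, Finset.mul_prod_erase _ _ hc0, ← hbκ, ← mul_assoc, hζ,
    smul_mul_assoc, dP_mul_eq_involute_mul, mul_assoc, hζ', mul_smul_comm, ← mul_assoc,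
    ← dP_mul_eq_involute_mul, mul_assoc]

theorem HypSplit.prod_pullForm_dvd (s : HypSplit c0 e) {A : Arrangement K ℓ} (hc0 : c0 ∈ A.hyps)
    {f : PS K n} (h : ∀ c ∈ A.hyps, c ≠ c0 →
      ∏ c' ∈ restrClass c0 e A c, linP (pullForm e c') ∣ f) :
    ∏ c ∈ A.hyps.erase c0, linP (pullForm e c) ∣ f := by
  have hne : ∀ c ∈ A.hyps.erase c0, pullForm e c ≠ 0 := fun c hc =>
    s.pullForm_ne_zero hc0 (Finset.mem_erase.1 hc).2 (Finset.mem_erase.1 hc).1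
  let g : (Fin ℓ → K) → Submodule K (Fin n → K) := fun c => K ∙ pullForm e c
  rw [← Finset.prod_fiberwise_of_maps_to (g := g) (t := (A.hyps.erase c0).image g)
    fun c hc => Finset.mem_image_of_mem g hc]
  refine Finset.prod_dvd_of_isRelPrime ?_ ?_
  · intro y _ y' _ hyy'
    refine IsRelPrime.prod_left fun c hc => IsRelPrime.prod_right fun d hd => ?_
    obtain ⟨hc, hcy⟩ := Finset.mem_filter.1 hc
    obtain ⟨hd, hdy⟩ := Finset.mem_filter.1 hd
    refine linP_isRelPrime (hne c hc) (hne d hd) fun t ht => hyy' ?_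
    rw [← hcy, ← hdy]
    have ht0 : t ≠ 0 := by
      rintro rfl
      exact hne c hc (by rw [ht, zero_smul])
    simp only [g]
    rw [ht, Submodule.span_singleton_smul_eq (IsUnit.mk0 t ht0)]
  · intro y hy
    obtain ⟨c, hc, rfl⟩ := Finset.mem_image.1 hy
    obtain ⟨hcc0, hcA⟩ := Finset.mem_erase.1 hc
    refine (Finset.prod_dvd_prod_of_subset _ _ _ fun c' hc' => ?_).trans (h c hcA hcc0)
    obtain ⟨hc', hg⟩ := Finset.mem_filter.1 hc'
    obtain ⟨hc'c0, hc'A⟩ := Finset.mem_erase.1 hc'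
    refine Finset.mem_filter.2 ⟨hc'A, hc'c0, ?_⟩
    have h1 : pullForm e c' ∈ K ∙ pullForm e c := by
      have : pullForm e c' ∈ g c' := Submodule.mem_span_singleton_self _
      rwa [hg] at this
    obtain ⟨t, ht⟩ := Submodule.mem_span_singleton.1 h1
    refine ⟨t, ?_, ht.symm⟩
    rintro rfl
    exact hne c' hc' (by rw [← ht, zero_smul])

theorem HypSplit.zieglerModule_zero_le (s : HypSplit c0 e) {A : Arrangement K ℓ}
    (hc0 : c0 ∈ A.hyps) : zieglerModule c0 e A 0 ≤ s.resModule A 0 := by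
  rintro u ⟨hu0, hu⟩
  obtain ⟨f, rfl⟩ := mem_formsP_zero.1 hu0
  obtain ⟨F, rfl⟩ := s.prod_pullForm_dvd hc0 (f := f) fun c hc h => by
    have h1 := hu c hc h
    rw [mul_algebraMap_eq_smul] at h1
    exact dvd_of_formDvd_smul_dP (s.pullForm_ne_zero hc0 hc h) h1
  refine ⟨(∏ c ∈ A.hyps, linP c) • algebraMap _ _ (pullPoly s.r F),
    prod_linP_smul_mem (mem_formsP_zero.2 ⟨_, rfl⟩), ?_⟩
  have h1 := isRes_algebraMap (c0 := c0) (e := e)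
    ((∏ c ∈ A.hyps.erase c0, linP c) * pullPoly s.r F)
  rw [← mul_assoc, Finset.mul_prod_erase _ _ hc0, map_mul (pullPoly e), s.pullPoly_pullPoly_r,
    map_prod] at h1
  simp only [pullPoly_linP] at h1
  rwa [Algebra.smul_def, ← map_mul]

end ResidueCalculus

section Surjectivity

variable {n : ℕ} {c0 : Fin ℓ → K} {e : (Fin n → K) →ₗ[K] (Fin ℓ → K)}

/-- The combination of two coordinate functionals of a frame that annihilates `dc0`. -/
def LogFrame.ψ {A : Arrangement K ℓ} {I : Type} [Fintype I] (F : LogFrame A c0 I) (i0 j : I) :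
    Module.Dual (PS K ℓ) (Fin ℓ → PS K ℓ) :=
  F.f i0 • F.θ j - F.f j • F.θ i0

section

variable {A : Arrangement K ℓ} {I : Type} [Fintype I] (F : LogFrame A c0 I) (i0 : I)

theorem LogFrame.ψ_c0 (j : I) : F.ψ i0 j (fun i => C (c0 i)) = 0 := by
  rw [LogFrame.ψ, LinearMap.sub_apply, LinearMap.smul_apply, LinearMap.smul_apply, F.θ_c0, F.θ_c0,
    smul_eq_mul, smul_eq_mul]
  ring

theorem LogFrame.ψ_dvd (j : I) (c : Fin ℓ → K) (hc : c ∈ A.hyps) :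
    linP c ∣ F.ψ i0 j fun i => C (c i) := by
  rw [LogFrame.ψ, LinearMap.sub_apply, LinearMap.smul_apply, LinearMap.smul_apply]
  exact dvd_sub ((F.θ_dvd j c hc).mul_left _) ((F.θ_dvd i0 c hc).mul_left _)

theorem LogFrame.contr_ψ_b (hc0 : c0 ∈ A.hyps) (j : I) {i : I} (hi : i ≠ i0) :
    contr (F.ψ i0 j) (F.b i) = algebraMap _ _
      (linP c0 * if i = j then (∏ c ∈ A.hyps.erase c0, linP c) * F.f i0 else 0) := by
  rw [LogFrame.ψ, contr_sub_smul, F.θ_b, F.θ_b, if_neg hi, map_zero, smul_zero, sub_zero,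
    Algebra.smul_def, ← map_mul]
  split_ifs
  · rw [← mul_assoc (linP c0), Finset.mul_prod_erase _ _ hc0, mul_comm]
  · rw [mul_zero, mul_zero]

theorem LogFrame.isRes_b_pairing (s : HypSplit c0 e) (hc0 : c0 ∈ A.hyps) {i j : I} (hi : i ≠ i0)
    {w : ExtF K n} (hw : IsRes c0 e (F.b i) w) {d' : Module.Dual (PS K n) (Fin n → PS K n)}
    (hd' : ∀ c : Fin ℓ → K, pullPoly e (F.ψ i0 j fun i => C (c i)) =
      d' fun i => C (pullForm e c i)) :
    contr d' w = algebraMap _ _ (if i = j then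
      pullPoly e (∏ c ∈ A.hyps.erase c0, linP c) * pullPoly e (F.f i0) else 0) := by
  have h1 := hw.contr (F.ψ_c0 i0 j) hd'
  rw [F.contr_ψ_b i0 hc0 j hi] at h1
  rw [h1.unique s (isRes_algebraMap _)]
  split_ifs
  · rw [map_mul]
  · rw [map_zero]

/-- The restricted functionals generate, up to a scalar, all constant vector fields. -/
theorem LogFrame.exists_sum_ψ_eq (s : HypSplit c0 e) (hc0 : c0 ∈ A.hyps) (k : Fin n)
    {d' : I → Module.Dual (PS K n) (Fin n → PS K n)}
    (hd' : ∀ j, ∀ c : Fin ℓ → K, pullPoly e (F.ψ i0 j fun i => C (c i)) =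
      d' j fun i => C (pullForm e c i)) :
    ∃ μ : I → PS K n, ∑ j ∈ Finset.univ.erase i0, μ j • d' j =
      (pullPoly e (∏ c ∈ A.hyps.erase c0, linP c) * pullPoly e (F.f i0)) •
        (LinearMap.proj k : Module.Dual (PS K n) (Fin n → PS K n)) := by
  let v : Fin ℓ → K := e (Pi.single k 1)
  have hα := s.linP_c0_ne_zero
  have hv0 : ∑ i, c0 i * v i = 0 := s.c0_e _
  have hμ : ∀ j, ∃ μ, contr (constDual v) (F.b j) = algebraMap _ _ (linP c0 * μ) := by
    intro j
    obtain ⟨h1, h2⟩ := mem_Omega_one_iff.1 (F.b_mem j)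
    obtain ⟨g, hg⟩ := mem_formsP_zero.1 (contr_mem_formsP (constDual v) h1)
    have h3 := (h2 c0 hc0).map (contr (constDual v))
    rw [contr_dP_mul, constDual_C, hv0, C_0, zero_smul, zero_sub, hg, mul_algebraMap_eq_smul,
      ← neg_smul] at h3
    obtain ⟨μ, hμ⟩ := dvd_of_formDvd_smul_dP s.c0_ne_zero h3
    exact ⟨-μ, by rw [hg, mul_neg, ← hμ, neg_neg]⟩
  choose μ hμ using hμ
  have hf : ∑ j, F.f j * μ j = 0 := by
    have h1 := congrArg (contr (constDual v)) F.sum_f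
    rw [map_smul, contr_dP, constDual_C, hv0, C_0, map_zero, smul_zero, map_sum] at h1
    simp only [map_smul, hμ] at h1
    simp only [Algebra.smul_def, ← map_mul] at h1
    rw [← map_sum, ← map_zero (algebraMap (PS K ℓ) (ExtF K ℓ))] at h1
    have h2 := algebraMap_extF_injective h1
    refine mul_left_cancel₀ hα ?_
    rw [mul_zero, Finset.mul_sum, ← h2]
    exact Finset.sum_congr rfl fun j _ => by ring
  have hθ : ∀ c : Fin ℓ → K, ∑ j, (F.θ j fun i => C (c i)) * μ j =
      (∏ c ∈ A.hyps.erase c0, linP c) * C (∑ i, c i * v i) := by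
    intro c
    have h1 := congrArg (contr (constDual v)) (F.sum_θ c)
    rw [map_smul, contr_dP, constDual_C, map_sum] at h1
    simp only [map_smul, hμ] at h1
    simp only [Algebra.smul_def, ← map_mul] at h1
    rw [← map_sum] at h1
    have h2 := algebraMap_extF_injective h1
    refine mul_left_cancel₀ hα ?_
    rw [← mul_assoc, Finset.mul_prod_erase _ _ hc0, ← h2, Finset.mul_sum]
    exact Finset.sum_congr rfl fun j _ => by ring
  have hψ : ∀ c : Fin ℓ → K, ∑ j ∈ Finset.univ.erase i0, μ j * (F.ψ i0 j fun i => C (c i)) =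
      (∏ c ∈ A.hyps.erase c0, linP c) * F.f i0 * C (∑ i, c i * v i) := by
    intro c
    have h1 : ∑ j ∈ Finset.univ.erase i0, μ j * (F.ψ i0 j fun i => C (c i)) =
        ∑ j, μ j * (F.ψ i0 j fun i => C (c i)) := by
      refine Finset.sum_subset (Finset.subset_univ _) fun j _ hj => ?_
      have : j = i0 := by simpa using hj
      rw [this, LogFrame.ψ, sub_self, LinearMap.zero_apply, mul_zero]
    have h2 : ∀ j, μ j * (F.ψ i0 j fun i => C (c i)) =
        F.f i0 * ((F.θ j fun i => C (c i)) * μ j) -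
          (F.θ i0 fun i => C (c i)) * (F.f j * μ j) := by
      intro j
      rw [LogFrame.ψ, LinearMap.sub_apply, LinearMap.smul_apply, LinearMap.smul_apply,
        smul_eq_mul, smul_eq_mul]
      ring
    rw [h1]
    simp only [h2]
    rw [Finset.sum_sub_distrib, ← Finset.mul_sum, ← Finset.mul_sum, hθ, hf]
    ring
  refine ⟨fun j => pullPoly e (μ j), LinearMap.pi_ext' fun i => LinearMap.ext_ring ?_⟩
  have hX : (Pi.single i 1 : Fin n → PS K n) =
      fun a => C (pullForm e (pullForm s.r (Pi.single i 1)) a) := by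
    rw [s.pullForm_pullForm_r]
    ext1 a
    simp only [Pi.single_apply, apply_ite C, C_1, C_0]
  have h1 := congrArg (pullPoly e) (hψ (pullForm s.r (Pi.single i 1)))
  rw [map_sum, map_mul, map_mul, pullPoly_C] at h1
  simp only [map_mul, hd'] at h1
  simp only [LinearMap.comp_apply, LinearMap.single_apply, LinearMap.sum_apply,
    LinearMap.smul_apply, LinearMap.proj_apply, smul_eq_mul]
  rw [hX, h1]
  congr 2

theorem LogFrame.exists_pow_smul_mem (s : HypSplit c0 e) (hc0 : c0 ∈ A.hyps) (p : ℕ) :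
    ∀ u ∈ zieglerModule c0 e A p, ∃ k : ℕ, pullPoly e (F.f i0) ^ k • u ∈ s.resModule A p := by
  set h := pullPoly e (F.f i0) with hh
  by_cases h0 : h = 0
  · intro u _
    exact ⟨1, by rw [pow_one, h0, zero_smul]; exact zero_mem _⟩
  set q := pullPoly e (∏ c ∈ A.hyps.erase c0, linP c) with hq
  have hq0 : q ≠ 0 := by
    rw [hq, map_prod]
    refine Finset.prod_ne_zero_iff.2 fun c hc => ?_
    rw [pullPoly_linP]
    exact linP_ne_zero (s.pullForm_ne_zero hc0 (Finset.mem_erase.1 hc).2 (Finset.mem_erase.1 hc).1)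
  choose d hd using fun j => s.exists_restrict (F.ψ i0 j) (by rw [F.ψ_c0, map_zero])
  choose w hw using fun j => s.exists_isRes ((mem_Omega_one_iff.1 (F.b_mem j)).2 c0 hc0)
  have hdw : ∀ i j, i ≠ i0 → contr (d j) (w i) = algebraMap _ _ (if i = j then q * h else 0) :=
    fun i j hi => F.isRes_b_pairing i0 s hc0 hi (hw i) (hd j)
  have hwι : ∀ i, ∃ a, w i = ExteriorAlgebra.ι _ a := fun i =>
    mem_formsP_one ((hw i).mem_formsP s (mem_Omega_one_iff.1 (F.b_mem i)).1)
  have hdwx : ∀ i j x, i ≠ i0 → contr (d j) (w i * x) =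
      (if i = j then q * h else 0) • x - w i * contr (d j) x := by
    intro i j x hi
    have h1 := hdw i j hi
    obtain ⟨a, ha⟩ := hwι i
    rw [ha, contr_ι] at h1
    rw [ha, contr_ι_mul, algebraMap_extF_injective h1]
  have hdT : ∀ j p u, u ∈ zieglerModule c0 e A (p + 1) → contr (d j) u ∈ zieglerModule c0 e A p :=
    fun j p u hu => s.contr_mem_zieglerModule (F.ψ_c0 i0 j) (F.ψ_dvd i0 j) (hd j) hu
  induction p with
  | zero =>
    intro u hu
    exact ⟨0, by rw [pow_zero, one_smul]; exact s.zieglerModule_zero_le hc0 hu⟩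
  | succ p ih =>
    intro u hu
    have key : ∀ t : Finset I, i0 ∉ t → ∃ k : ℕ, ∃ y ∈ s.resModule A (p + 1),
        ∀ i ∈ t, contr (d i) (h ^ k • u - y) = 0 := by
      intro t
      induction t using Finset.induction_on with
      | empty => exact fun _ => ⟨0, 0, zero_mem _, by simp⟩
      | insert j t hjt iht =>
        intro hi0
        have hj0 : j ≠ i0 := fun hj => hi0 (by rw [hj]; exact Finset.mem_insert_self _ _)
        obtain ⟨k, y, hy, hky⟩ := iht fun hi => hi0 (Finset.mem_insert_of_mem hi)
        set u1 := h ^ k • u - y with hu1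
        have hu1T : u1 ∈ zieglerModule c0 e A (p + 1) :=
          sub_mem (Submodule.smul_mem _ _ hu) (s.resModule_le hc0 _ hy)
        obtain ⟨m, hm⟩ := ih _ (hdT j p u1 hu1T)
        obtain ⟨y', hy', hqy'⟩ := s.exists_smul_eq_mul hc0 (F.b_mem j) (hw j) hm
        have hsplit : h ^ (m + 1 + k) • u - (h ^ (m + 1) • y + y') = h ^ (m + 1) • u1 - y' := by
          rw [hu1, smul_sub, smul_smul, ← pow_add, sub_sub]
        refine ⟨m + 1 + k, h ^ (m + 1) • y + y',
          add_mem (Submodule.smul_mem _ _ hy) hy', fun i hi => ?_⟩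
        rw [hsplit]
        refine smul_right_injective _ hq0 ?_
        beta_reduce
        rw [smul_zero, ← map_smul, smul_sub, hqy', map_sub, hdwx _ _ _ hj0]
        rcases Finset.mem_insert.1 hi with rfl | hi
        · rw [if_pos rfl, map_smul (contr (d i)) (h ^ m), contr_contr, smul_zero, mul_zero,
            sub_zero, map_smul, map_smul, smul_smul, smul_smul, ← sub_smul]
          rw [show q * h ^ (m + 1) - q * h * h ^ m = 0 by ring, zero_smul]
        · have hji : j ≠ i := fun h => hjt (h ▸ hi)
          rw [if_neg hji, map_smul (contr (d i)) (h ^ m), contr_comm, hky i hi, map_smul, map_smul,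
            hky i hi]
          simp
    obtain ⟨k, y, hy, hk⟩ := key (Finset.univ.erase i0) (Finset.notMem_erase _ _)
    refine ⟨k, ?_⟩
    suffices h ^ k • u - y = 0 by
      rw [sub_eq_zero.1 this]
      exact hy
    have huy : h ^ k • u - y ∈ formsP K n (p + 1) :=
      sub_mem (Submodule.smul_mem _ _ hu.1) (s.resModule_le hc0 _ hy).1
    refine eq_zero_of_contr_proj_eq_zero huy fun a => ?_
    obtain ⟨μ, hμ⟩ := F.exists_sum_ψ_eq i0 s hc0 a hd
    have h1 := contr_sum_smul (Finset.univ.erase i0) μ d (h ^ k • u - y)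
    have h3 : ∑ i ∈ Finset.univ.erase i0, μ i • contr (d i) (h ^ k • u - y) = 0 :=
      Finset.sum_eq_zero fun i hi => by rw [hk i hi, smul_zero]
    rw [h3, hμ] at h1
    have h2 : contr ((q * h) • (LinearMap.proj a : Module.Dual (PS K n) (Fin n → PS K n)))
        (h ^ k • u - y) = (q * h) • contr (LinearMap.proj a) (h ^ k • u - y) := by
      simp only [contr, map_smul, LinearMap.smul_apply]
    rw [h2] at h1
    exact (smul_eq_zero.1 h1).resolve_left (mul_ne_zero hq0 h0)

end

/-- Along a free arrangement, every form that satisfies the conditions of the Ziegler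
restriction is a residue. -/
theorem HypSplit.zieglerModule_le_of_freeM (s : HypSplit c0 e) {A : Arrangement K ℓ}
    (hc0 : c0 ∈ A.hyps) (hA : FreeM A fun _ => 1) (p : ℕ) :
    zieglerModule c0 e A p ≤ s.resModule A p := by
  intro u hu
  obtain ⟨I, _, ⟨F⟩⟩ := exists_logFrame hc0 hA
  let J : Ideal (PS K n) := (s.resModule A p).comap (LinearMap.toSpanSingleton (PS K n) _ u)
  have hJ : ∀ g, g ∈ J ↔ g • u ∈ s.resModule A p := fun g => Iff.rfl
  suffices J = ⊤ by
    have h1 : (1 : PS K n) ∈ J := this ▸ Submodule.mem_top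
    rwa [hJ, one_smul] at h1
  by_contra hne
  obtain ⟨M, hM, hJM⟩ := Ideal.exists_le_maximal J hne
  refine hM.ne_top ((Ideal.eq_top_iff_one M).2 ?_)
  have h1 := congrArg (pullPoly e) F.sum_fg
  rw [map_one, map_sum] at h1
  rw [← h1]
  refine Submodule.sum_mem _ fun i _ => ?_
  rw [map_mul]
  obtain ⟨k, hk⟩ := F.exists_pow_smul_mem i s hc0 p u hu
  exact Ideal.mul_mem_right _ _ (hM.isPrime.mem_of_pow_mem k (hJM ((hJ _).2 hk)))

end Surjectivity

section Globalization

variable {n : ℕ} {c0 : Fin ℓ → K} {e : (Fin n → K) →ₗ[K] (Fin ℓ → K)}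

/-- A module of forms cut out by divisibility conditions is a second syzygy. -/
theorem pdLE_of_mem_iff_formDvd {I : Type} [Fintype I] {p : ℕ} (N : Submodule (PS K n) (ExtF K n))
    (q : I → PS K n) (hq : ∀ i, q i ≠ 0) (c : I → Fin n → K)
    (hN : ∀ u, u ∈ N ↔ u ∈ formsP K n p ∧ ∀ i, FormDvd (q i) (dP (c i) * u)) :
    pdLE (PS K n) (n - 2) N := by
  have hproj : Module.Projective (PS K n) (formsP K n p) :=
    inferInstanceAs (Module.Projective (PS K n) (⋀[PS K n]^p (Fin n → PS K n)))
  let f : (formsP K n p × (I → ExtF K n)) →ₗ[PS K n] (I → ExtF K n) :=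
    LinearMap.pi fun i => LinearMap.mulLeft (PS K n) (dP (c i)) ∘ₗ (formsP K n p).subtype ∘ₗ
      LinearMap.fst _ _ _ - q i • (LinearMap.proj i ∘ₗ LinearMap.snd _ _ _)
  have hf : ∀ x, x ∈ LinearMap.ker f ↔ ∀ i, dP (c i) * (x.1 : ExtF K n) = q i • x.2 i := by
    intro x
    rw [LinearMap.mem_ker, funext_iff]
    exact forall_congr' fun i => sub_eq_zero
  refine pdLE_of_linearEquiv (LinearEquiv.ofBijective
    (((formsP K n p).subtype ∘ₗ LinearMap.fst _ _ _ ∘ₗ (LinearMap.ker f).subtype).codRestrict N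
      fun x => (hN _).2 ⟨x.1.1.2, fun i => ⟨x.1.2 i, (hf _).1 x.2 i⟩⟩) ⟨?_, ?_⟩)
    (pdLE_ker_of_forall_pdLE (fun M => pdLE_mvPolynomial K n M) f)
  · rintro ⟨⟨a, x⟩, hx⟩ ⟨⟨b, y⟩, hy⟩ h
    have hab : a = b := Subtype.ext (congrArg (Subtype.val : N → ExtF K n) h)
    subst hab
    rw [hf] at hx hy
    have hxy : x = y := funext fun i =>
      smul_right_injective _ (hq i) ((hx i).symm.trans (hy i))
    subst hxy
    rfl
  · rintro ⟨u, hu⟩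
    obtain ⟨h1, h2⟩ := (hN u).1 hu
    choose z hz using h2
    exact ⟨⟨(⟨u, h1⟩, z), (hf _).2 hz⟩, rfl⟩

theorem linP_single (i : Fin n) : linP (Pi.single i (1 : K)) = X i := by
  rw [linP, Finset.sum_eq_single i]
  · simp
  · intro j _ hj
    simp [hj]
  · simp

theorem exists_X_pow_mem_of_prod_linP_mem (J : Ideal (PS K n))
    (hJ : ∀ y : Fin n → K, y ≠ 0 → ∃ T : Finset (Fin n → K),
      (∀ c ∈ T, ∑ i, c i * y i ≠ 0) ∧ ∃ k : ℕ, (∏ c ∈ T, linP c) ^ k ∈ J) :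
    ∃ k : ℕ, ∀ i, (X i : PS K n) ^ k ∈ J := by
  have key : ∀ i, (X i : PS K n) ∈ J.radical := by
    intro i
    rw [Ideal.radical_eq_sInf, Submodule.mem_sInf]
    rintro P ⟨hJP, hP⟩
    let W : Submodule K (Fin n → K) :=
      { carrier := {c | linP c ∈ P}
        add_mem' := fun {a b} ha hb => by
          rw [Set.mem_ofPred_eq, linP_add]
          exact add_mem ha hb
        zero_mem' := by
          rw [Set.mem_ofPred_eq, linP_zero]
          exact zero_mem P
        smul_mem' := fun t a ha => by
          rw [Set.mem_ofPred_eq, linP_smul]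
          exact Ideal.mul_mem_left P _ ha }
    suffices hW : W = ⊤ by
      have h1 : Pi.single i 1 ∈ W := hW ▸ Submodule.mem_top
      rw [← linP_single]
      exact h1
    by_contra hW
    obtain ⟨f, hf, hWf⟩ := W.exists_le_ker_of_lt_top (lt_top_iff_ne_top.2 hW)
    have hfy : ∀ c, ∑ i, c i * f (Pi.single i 1) = f c := by
      intro c
      conv_rhs => rw [← LinearMap.sum_single_apply _ c, map_sum]
      refine Finset.sum_congr rfl fun i _ => ?_
      rw [← smul_eq_mul, ← map_smul]
      congr 1
      ext j
      simp [Pi.single_apply]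
    obtain ⟨T, hT, k, hk⟩ := hJ (fun i => f (Pi.single i 1)) fun h => hf <| by
      ext i
      simpa using congrFun h i
    obtain ⟨c, hcT, hcP⟩ := (hP.prod_mem_iff).1 (hP.mem_of_pow_mem k (hJP hk))
    exact hT c hcT ((hfy c).trans (hWf hcP))
  choose k hk using key
  exact ⟨∑ i, k i, fun i =>
    J.pow_mem_of_pow_mem (hk i)
      (Finset.single_le_sum (fun _ _ => Nat.zero_le _) (Finset.mem_univ i))⟩

theorem mem_zieglerModule_locArr {A : Arrangement K ℓ} {p : ℕ} {u : ExtF K n} (x : Fin ℓ → K)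
    (hu : u ∈ zieglerModule c0 e A p) : u ∈ zieglerModule c0 e (locArr A x) p := by
  refine ⟨hu.1, fun c hc h => (hu.2 c (Finset.mem_filter.1 hc).1 h).of_dvd ?_⟩
  exact Finset.prod_dvd_prod_of_subset _ _ _
    (Finset.filter_subset_filter _ (Finset.filter_subset _ _))

theorem prod_linP_smul_mem_Omega {A : Arrangement K ℓ} {p : ℕ} {x : Fin ℓ → K} {η : ExtF K ℓ}
    (hη : η ∈ Omega (locArr A x) (fun _ => 1) p) :
    (∏ c ∈ A.hyps.filter fun c => ∑ i, c i * x i ≠ 0, linP c) • η ∈ Omega A (fun _ => 1) p := by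
  rw [mem_Omega_one_iff] at hη ⊢
  refine ⟨Submodule.smul_mem _ _ hη.1, fun c hc => ?_⟩
  rw [mul_smul_comm]
  by_cases h : ∑ i, c i * x i = 0
  · exact (hη.2 c (Finset.mem_filter.2 ⟨hc, h⟩)).smul _
  · exact FormDvd.smul_of_dvd (Finset.dvd_prod_of_mem _ (Finset.mem_filter.2 ⟨hc, h⟩)) _

theorem HypSplit.exists_X_pow_smul_mem (s : HypSplit c0 e) (he : Function.Injective e)
    {A : Arrangement K ℓ} (hc0 : c0 ∈ A.hyps) (hlf : LocallyFreeAlong A (fun _ => 1) c0) {p : ℕ}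
    {u : ExtF K n} (hu : u ∈ zieglerModule c0 e A p) :
    ∃ k : ℕ, ∀ i, (X i : PS K n) ^ k • u ∈ s.resModule A p := by
  refine exists_X_pow_mem_of_prod_linP_mem
    ((s.resModule A p).comap (LinearMap.toSpanSingleton (PS K n) _ u)) fun y hy => ?_
  have hx0 : ∑ i, c0 i * e y i = 0 := s.c0_e y
  have hfree := hlf (e y) ((map_ne_zero_iff e he).2 hy) hx0
  have hu' := s.zieglerModule_le_of_freeM (Finset.mem_filter.2 ⟨hc0, hx0⟩) hfree p
    (mem_zieglerModule_locArr _ hu)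
  obtain ⟨η, hη, h⟩ := hu'
  set D := A.hyps.filter fun c => ∑ i, c i * e y i ≠ 0 with hD
  refine ⟨D.image (pullForm e), ?_, D.card, ?_⟩
  · intro c hc
    obtain ⟨d, hd, rfl⟩ := Finset.mem_image.1 hc
    rw [pullForm_apply_sum]
    exact (Finset.mem_filter.1 hd).2
  · have h1 : pullPoly e (∏ c ∈ D, linP c) ∣ (∏ c ∈ D.image (pullForm e), linP c) ^ D.card := by
      rw [map_prod, ← Finset.prod_const]
      refine Finset.prod_dvd_prod_of_dvd _ _ fun c hc => ?_
      rw [pullPoly_linP]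
      exact Finset.dvd_prod_of_mem _ (Finset.mem_image_of_mem _ hc)
    refine Ideal.mem_of_dvd _ h1 ?_
    exact ⟨_, prod_linP_smul_mem_Omega hη, h.smul _⟩

open RingTheory.Sequence in
theorem HypSplit.pdLE_zieglerModule (s : HypSplit c0 e) (he : Function.Injective e)
    {A : Arrangement K ℓ} (hc0 : c0 ∈ A.hyps) (hlf : LocallyFreeAlong A (fun _ => 1) c0) {p : ℕ}
    (hA : pdLE (PS K ℓ) p (Omega A (fun _ => 1) p)) :
    pdLE (PS K n) p (zieglerModule c0 e A p) := by
  by_cases hp : p + 2 ≤ n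
  · have h1 := s.pdLE_resModule hc0 hA
    suffices zieglerModule c0 e A p = s.resModule A p by rwa [this]
    refine le_antisymm (fun u hu => ?_) (s.resModule_le hc0 p)
    obtain ⟨k, hk⟩ := s.exists_X_pow_smul_mem he hc0 hlf hu
    refine mem_of_pdLE_of_isWeaklyRegular _ _ (isWeaklyRegular_X_pow K n k) p h1 (by simpa using hp)
      (fun x hx => ?_) u ?_
    · have h2 := hx (X ⟨0, by omega⟩ ^ k) (List.mem_map.2 ⟨_, List.mem_finRange _, rfl⟩)
      exact (smul_eq_zero.1 h2).resolve_left (pow_ne_zero _ (X_ne_zero _))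
    · intro r hr
      obtain ⟨i, -, rfl⟩ := List.mem_map.1 hr
      exact hk i
  · refine pdLE_mono (show n - 2 ≤ p by omega) (pdLE_of_mem_iff_formDvd (p := p)
      (I := {c // c ∈ A.hyps.erase c0}) _
      (fun c => ∏ c' ∈ restrClass c0 e A c.1, linP (pullForm e c'))
      (fun c => Finset.prod_ne_zero_iff.2 fun c' hc' => linP_ne_zero ?_) (fun c => pullForm e c.1)
      fun u => ?_)
    · obtain ⟨h1, h2, -⟩ := Finset.mem_filter.1 hc'
      exact s.pullForm_ne_zero hc0 h1 h2
    · rw [mem_zieglerModule_iff, Subtype.forall]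
      simp only [Finset.mem_erase, and_imp]
      exact and_congr_right fun _ => forall_congr' fun c => forall_comm

theorem FormDvd.of_associated {a b : PS K n} {x y : ExtF K n} (hab : Associated a b) {t : K}
    (h : FormDvd a x) (hxy : y = (C t : PS K n) • x) : FormDvd b y := by
  rw [hxy]
  exact (h.of_dvd hab.symm.dvd).smul _

theorem associated_linP_smul {t : K} (ht : t ≠ 0) (c : Fin n → K) :
    Associated (linP (t • c)) (linP c) := by
  rw [linP_smul]
  exact associated_unit_mul_left _ _ ((isUnit_iff_ne_zero.2 ht).map C)

theorem associated_prod_restrClass {A : Arrangement K ℓ} {c : Fin ℓ → K} {c' : Fin n → K} {t : K}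
    (ht : t ≠ 0) (hc : pullForm e c = t • c') :
    Associated (∏ d ∈ restrClass c0 e A c, linP (pullForm e d)) (linP c' ^
      (A.hyps.filter fun d => d ≠ c0 ∧ ∃ t : K, t ≠ 0 ∧ pullForm e d = t • c').card) := by
  have h1 : restrClass c0 e A c =
      A.hyps.filter fun d => d ≠ c0 ∧ ∃ t : K, t ≠ 0 ∧ pullForm e d = t • c' := by
    refine Finset.filter_congr fun d _ => and_congr_right fun _ => ?_
    constructor
    · rintro ⟨a, ha, h⟩
      exact ⟨a * t, mul_ne_zero ha ht, by rw [h, hc, smul_smul]⟩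
    · rintro ⟨a, ha, h⟩
      exact ⟨a * t⁻¹, mul_ne_zero ha (inv_ne_zero ht), by
        rw [h, hc, smul_smul, inv_mul_cancel_right₀ ht]⟩
  rw [h1, ← Finset.prod_const]
  refine Associated.prod _ _ _ fun d hd => ?_
  obtain ⟨-, -, a, ha, h⟩ := Finset.mem_filter.1 hd
  rw [h]
  exact associated_linP_smul ha c'

theorem Omega_zieglerMult_eq {A : Arrangement K ℓ} {c0 : Fin ℓ → K}
    {e : (Fin (ℓ - 1) → K) →ₗ[K] (Fin ℓ → K)} {B : Arrangement K (ℓ - 1)}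
    (hB : IsRestrictionOf B A c0 e) (p : ℕ) :
    Omega B (zieglerMult A c0 e) p = zieglerModule c0 e A p := by
  ext u
  rw [mem_Omega_iff, mem_zieglerModule_iff]
  refine and_congr_right fun _ => ⟨fun h c hc hne => ?_, fun h c' hc' => ?_⟩
  · obtain ⟨c', hc', t, ht, hct⟩ := hB.1 c hc hne
    refine (h c' hc').of_associated (t := t) (associated_prod_restrClass ht hct).symm ?_
    rw [← smul_mul_assoc, ← dP_smul, ← hct]
    rfl
  · obtain ⟨c, hc, hne, t, ht, hct⟩ := hB.2 c' hc'
    refine (h c hc hne).of_associated (t := t⁻¹) (associated_prod_restrClass ht hct) ?_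
    rw [← smul_mul_assoc, ← dP_smul, show pullForm e c = t • c' from hct, smul_smul,
      inv_mul_cancel₀ ht, one_smul]

end Globalization

/-- If `A` is tame and locally free along `H ∈ A`, then the Ziegler restriction
`(A^H, m^H)` is tame: `pd_{S̄} Ω^p(A^H, m^H) ≤ p` for all `0 ≤ p ≤ ℓ - 1`. -/
theorem ziegler_restriction_of_tame_is_tame
    {K : Type} [Field K] {ℓ : ℕ} (A : Arrangement K ℓ) (hess : Essential A)
    (c0 : Fin ℓ → K) (hc0 : c0 ∈ A.hyps)
    (hA_tame : Tame A) (hlf : LocallyFreeAlong A (fun _ => 1) c0) :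
    ∀ (e : (Fin (ℓ - 1) → K) →ₗ[K] (Fin ℓ → K)) (B : Arrangement K (ℓ - 1)),
      IsHypEmbedding c0 e → IsRestrictionOf B A c0 e →
        TameM B (zieglerMult A c0 e) := by
  intro e B he hB p hp
  obtain ⟨s⟩ := exists_hypSplit (A.ne_zero c0 hc0) he.1 he.2
  rw [Omega_zieglerMult_eq hB]
  exact s.pdLE_zieglerModule he.1 hc0 hlf (hA_tame p (hp.trans (Nat.sub_le _ _)))
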